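/- arXiv:math/0701919 — 3 statements merged into one kernel-verified Lean document; each statement's English description precedes it below -/
import Mathlib

section
/- Let K be an algebraically closed field, λ1,...,λℓ independent indeterminates, and P, Q1, ..., Qℓ ∈ K[x_1,...,x_n] relatively prime. Suppose F = P + λ1·Q1 + ··· + λℓ·Qℓ factors in (algebraic closure of K(λ))[x_1,...,x_n] as α·M^d for some α in the algebraic closure of K(λ), M ∈ (algebraic closure of K(λ))[x_1,...,x_n] and d ≥ 1, in characteristic 0. Then deg_x(M) = 0 or d = 1. -/
open MvPolynomial

/-- The algebraic closure of the rational function field `K(λ₁,…,λ_l)`. -/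
noncomputable abbrev LamClosure (K : Type*) [Field K] (l : ℕ) : Type _ :=
  AlgebraicClosure (FractionRing (MvPolynomial (Fin l) K))

/-- The canonical embedding `K → closure of K(λ₁,…,λ_l)`. -/
noncomputable def lamEmb (K : Type*) [Field K] (l : ℕ) : K →+* LamClosure K l :=
  (algebraMap (FractionRing (MvPolynomial (Fin l) K)) (LamClosure K l)).comp
    ((algebraMap (MvPolynomial (Fin l) K) (FractionRing (MvPolynomial (Fin l) K))).comp
      MvPolynomial.C)

/-- The indeterminate `λᵢ` viewed in the closure of `K(λ₁,…,λ_l)`. -/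
noncomputable def lamVar (K : Type*) [Field K] (l : ℕ) (i : Fin l) : LamClosure K l :=
  algebraMap (FractionRing (MvPolynomial (Fin l) K)) (LamClosure K l)
    (algebraMap (MvPolynomial (Fin l) K) (FractionRing (MvPolynomial (Fin l) K)) (X i))

namespace MvPolynomial

/-- The derivation of `R[x]` acting on coefficients by a derivation of `R`. -/
noncomputable def coeffDerivation {k R σ : Type*} [CommRing k] [CommRing R] [Algebra k R]
    (D : Derivation k R R) : Derivation k (MvPolynomial σ R) (MvPolynomial σ R) :=
  have coeff_sum_monomial (p : MvPolynomial σ R) (m : σ →₀ ℕ) :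
      coeff m (∑ s ∈ p.support, monomial s (D (coeff s p))) = D (coeff m p) := by
    classical
    simp +contextual [coeff_sum, coeff_monomial]
  Derivation.mk'
    { toFun := fun p ↦ ∑ s ∈ p.support, monomial s (D (coeff s p))
      map_add' := fun p q ↦ by ext m; rw [coeff_add]; simp_rw [coeff_sum_monomial, coeff_add, _root_.map_add]
      map_smul' := fun c p ↦ by
        ext m; simp_rw [coeff_sum_monomial, RingHom.id_apply, coeff_smul, coeff_sum_monomial, D.map_smul] }
    fun p q ↦ by
      classical
      ext m
      simp only [LinearMap.coe_mk, AddHom.coe_mk, smul_eq_mul, mul_comm q]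
      rw [coeff_sum_monomial]
      simp_rw [coeff_add, coeff_mul, coeff_sum_monomial, map_sum, Derivation.leibniz,
        Finset.sum_add_distrib, smul_eq_mul, mul_comm]

theorem coeff_coeffDerivation {k R σ : Type*} [CommRing k] [CommRing R] [Algebra k R]
    (D : Derivation k R R) (p : MvPolynomial σ R) (m : σ →₀ ℕ) :
    coeff m (coeffDerivation D p) = D (coeff m p) := by
  classical
  change coeff m (∑ s ∈ p.support, monomial s (D (coeff s p))) = _
  simp +contextual [coeff_sum, coeff_monomial]

theorem coeffDerivation_C {k R σ : Type*} [CommRing k] [CommRing R] [Algebra k R]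
    (D : Derivation k R R) (a : R) :
    coeffDerivation D (C a : MvPolynomial σ R) = C (D a) := by
  classical
  ext m
  simp only [coeff_coeffDerivation, coeff_C]
  split_ifs <;> simp

theorem coeffDerivation_map {k R σ : Type*} [CommRing k] [CommRing R] [Algebra k R]
    (D : Derivation k R R) (p : MvPolynomial σ k) :
    coeffDerivation D (map (algebraMap k R) p) = 0 := by
  ext m
  simp [coeff_coeffDerivation, coeff_map]

theorem dvd_coeffDerivation_of_eq_C_mul_pow {k R σ : Type*} [CommRing k] [CommRing R]
    [Algebra k R] (D : Derivation k R R) {F M : MvPolynomial σ R} {a : R} {d : ℕ} (hd : 2 ≤ d)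
    (h : F = C a * M ^ d) : M ∣ coeffDerivation D F := by
  rw [h, Derivation.leibniz, Derivation.leibniz_pow, smul_eq_mul, smul_eq_mul]
  refine dvd_add (Dvd.dvd.mul_left ?_ _) (Dvd.dvd.mul_right (dvd_pow_self _ (by lia)) _)
  rw [nsmul_eq_mul]
  exact Dvd.dvd.mul_left (Dvd.dvd.mul_right (dvd_pow_self _ (by lia)) _) _

end MvPolynomial

/-- Over an algebraically closed field, a nonzero finitely generated algebra has a rational point. -/
theorem Algebra.FiniteType.nonempty_algHom_of_isAlgClosed (K R : Type*) [Field K] [IsAlgClosed K]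
    [CommRing R] [Nontrivial R] [Algebra K R] [Algebra.FiniteType K R] :
    Nonempty (R →ₐ[K] K) := by
  obtain ⟨m, hm⟩ := Ideal.exists_maximal R
  let := Ideal.Quotient.field m
  have : Module.Finite K (R ⧸ m) := finite_of_finite_type_of_isJacobsonRing K (R ⧸ m)
  exact ⟨(IsAlgClosed.lift (R := K) (S := R ⧸ m) (M := K)).comp (Ideal.Quotient.mkₐ K m)⟩

/-- Common divisors descend along an extension of an algebraically closed field, without becoming
constant. -/
theorem MvPolynomial.exists_dvd_of_map_dvd {K L σ ι : Type*} [Field K] [IsAlgClosed K] [Field L]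
    [Algebra K L] [Finite ι] (p : ι → MvPolynomial σ K) (M : MvPolynomial σ L)
    (hM : ∀ i, M ∣ map (algebraMap K L) (p i)) {m : σ →₀ ℕ} (hm : coeff m M ≠ 0) :
    ∃ r : MvPolynomial σ K, coeff m r ≠ 0 ∧ ∀ i, r ∣ p i := by
  classical
  have := Fintype.ofFinite ι
  choose A hA using hM
  let s : Finset L :=
    insert (coeff m M)⁻¹ (M.coeffs ∪ Finset.univ.biUnion fun i ↦ (A i).coeffs)
  let R := Algebra.adjoin K (s : Set L)
  have hR : Algebra.FiniteType K R := Subalgebra.fg_iff_finiteType _ |>.mp ⟨s, rfl⟩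
  have hs : (s : Set L) ⊆ R := Algebra.subset_adjoin
  have hrange : Set.range (algebraMap R L) = R := Subtype.range_coe
  have hinj : Function.Injective (algebraMap R L) := Subtype.val_injective
  obtain ⟨M', hM'⟩ : M ∈ Set.range (map (algebraMap R L)) := by
    rw [mem_range_map_iff_coeffs_subset, hrange]
    exact fun x hx ↦ hs (by simp_all [s])
  have hA' : ∀ i, A i ∈ Set.range (map (algebraMap R L)) := fun i ↦ by
    rw [mem_range_map_iff_coeffs_subset, hrange]
    refine fun x hx ↦ hs ?_
    simp only [s, Finset.coe_insert, Finset.coe_union, Finset.coe_biUnion]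
    exact Or.inr (Or.inr (Set.mem_biUnion (Finset.mem_coe.2 (Finset.mem_univ i)) hx))
  choose A' hA' using hA'
  have hdvd : ∀ i, map (algebraMap K R) (p i) = M' * A' i := fun i ↦ by
    apply map_injective _ hinj
    rw [map_mul, hM', hA', ← hA, map_map, ← IsScalarTower.algebraMap_eq]
  have hunit : IsUnit (coeff m M') := by
    refine IsUnit.of_mul_eq_one ⟨(coeff m M)⁻¹, hs (by simp [s])⟩ (hinj ?_)
    rw [_root_.map_mul, _root_.map_one, ← coeff_map, hM']
    exact mul_inv_cancel₀ hm
  obtain ⟨φ⟩ := Algebra.FiniteType.nonempty_algHom_of_isAlgClosed K R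
  refine ⟨map (φ : R →+* K) M', ?_, fun i ↦ ⟨map (φ : R →+* K) (A' i), ?_⟩⟩
  · rw [coeff_map]
    exact (hunit.map _).ne_zero
  · rw [← map_mul, ← hdvd, map_map, φ.comp_algebraMap]
    exact (map_id _).symm

/-- A derivation with values in a formally étale algebra extends to that algebra. -/
theorem Derivation.exists_extension_of_formallyEtale {k A B : Type*} [CommRing k] [CommRing A]
    [CommRing B] [Algebra k A] [Algebra k B] [Algebra A B] [IsScalarTower k A B]
    [Algebra.FormallyEtale A B] (D : Derivation k A B) :
    ∃ D' : Derivation k B B, ∀ a, D' (algebraMap A B a) = D a := by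
  let h := KaehlerDifferential.isBaseChange_of_formallyEtale k A B
  refine ⟨(h.lift D.liftKaehlerDifferential).compDer (KaehlerDifferential.D k B), fun a ↦ ?_⟩
  change h.lift _ (KaehlerDifferential.D k B (algebraMap A B a)) = D a
  rw [← KaehlerDifferential.map_D k k A B, h.lift_eq,
    Derivation.liftKaehlerDifferential_comp_D]

instance {K : Type*} [Field K] [CharZero K] (l : ℕ) :
    Algebra.FormallyEtale (MvPolynomial (Fin l) K) (LamClosure K l) :=
  have := Algebra.FormallyEtale.of_isLocalization (Rₘ := FractionRing (MvPolynomial (Fin l) K))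
    (nonZeroDivisors (MvPolynomial (Fin l) K))
  have := Algebra.FormallyEtale.of_isSeparable (FractionRing (MvPolynomial (Fin l) K))
    (LamClosure K l)
  .comp _ (FractionRing (MvPolynomial (Fin l) K)) _

theorem lamEmb_eq_algebraMap (K : Type*) [Field K] (l : ℕ) :
    lamEmb K l = algebraMap K (LamClosure K l) := rfl

theorem lamVar_eq_algebraMap (K : Type*) [Field K] (l : ℕ) (i : Fin l) :
    lamVar K l i = algebraMap (MvPolynomial (Fin l) K) (LamClosure K l) (X i) := rfl

/-- The partial derivative with respect to `λᵢ` on the closure of `K(λ₁,…,λ_l)`. -/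
theorem exists_derivation_lamVar (K : Type*) [Field K] [CharZero K] (l : ℕ) (i : Fin l) :
    ∃ D : Derivation K (LamClosure K l) (LamClosure K l),
      ∀ j, D (lamVar K l j) = if j = i then 1 else 0 := by
  obtain ⟨D, hD⟩ := (mkDerivation K fun j : Fin l ↦
    if j = i then (1 : LamClosure K l) else 0).exists_extension_of_formallyEtale
  exact ⟨D, fun j ↦ by rw [lamVar_eq_algebraMap, hD, mkDerivation_X]⟩

/-- In characteristic 0, with `P, Q₁, …, Q_l` relatively prime,
if `F = P + λ₁Q₁ + ⋯ + λ_l Q_l = α · M^d` over the algebraic closure of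
`K(λ)`, then `M` is constant in `x` or `d = 1`. -/
theorem not_proper_power
    {K : Type*} [Field K] [IsAlgClosed K] [CharZero K] {n l : ℕ} (hl : 1 ≤ l)
    (P : MvPolynomial (Fin n) K) (Q : Fin l → MvPolynomial (Fin n) K)
    (hcop : ∀ r : MvPolynomial (Fin n) K, (r ∣ P ∧ ∀ i, r ∣ Q i) → IsUnit r)
    (F : MvPolynomial (Fin n) (LamClosure K l))
    (hF : F = MvPolynomial.map (lamEmb K l) P +
      ∑ i : Fin l, C (lamVar K l i) * MvPolynomial.map (lamEmb K l) (Q i))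
    (α : LamClosure K l) (M : MvPolynomial (Fin n) (LamClosure K l)) (d : ℕ)
    (hd : 1 ≤ d) (hfac : F = C α * M ^ d) :
    M.totalDegree = 0 ∨ d = 1 := by
  rw [or_iff_not_imp_right]
  intro hd1
  by_contra hM
  obtain ⟨m, hmM, hm⟩ : ∃ m ∈ M.support, m ≠ 0 := by
    by_contra! h
    refine hM ((totalDegree_eq_zero_iff _ M).2 fun m hm x ↦ ?_)
    simp [h m hm]
  rw [lamEmb_eq_algebraMap] at hF
  have hQ : ∀ i, M ∣ map (algebraMap K (LamClosure K l)) (Q i) := fun i ↦ by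
    obtain ⟨D, hD⟩ := exists_derivation_lamVar K l i
    have h := dvd_coeffDerivation_of_eq_C_mul_pow D (by lia) hfac
    simpa [hF, coeffDerivation_map, coeffDerivation_C, Derivation.leibniz, hD] using h
  have hP : M ∣ map (algebraMap K (LamClosure K l)) P := by
    have hMF : M ∣ F := hfac ▸ (dvd_pow_self M (by lia)).mul_left _
    rw [hF] at hMF
    exact (dvd_add_left (Finset.dvd_sum fun i _ ↦ (hQ i).mul_left _)).1 hMF
  obtain ⟨r, hr, hdvd⟩ := exists_dvd_of_map_dvd (fun o : Option (Fin l) ↦ o.elim P Q) M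
    (by rintro (_ | i) <;> simp [hP, hQ]) (mem_support_iff.1 hmM)
  obtain ⟨c, -, rfl⟩ := isUnit_iff_eq_C_of_isReduced.1
    (hcop r ⟨hdvd none, fun i ↦ hdvd (some i)⟩)
  exact hr (by rw [coeff_C, if_neg hm.symm])
end

section
/- Let K be an algebraically closed field of characteristic 0 and P ∈ K[x,y] a homogeneous polynomial of degree d > 1 that is not a pure power. Let Q = x^i·y^j be a monomial with i + j < d and gcd(P, Q) = 1. Then P(x,y) + λ*·x^i·y^j is irreducible in K[x,y] for all but at most deg(P)^2 − 1 values of λ* ∈ K. -/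
open MvPolynomial

/-- If `α ^ m` and `α ^ n` lie in the subfield `F`, then so does `α ^ gcd m n`. -/
theorem exists_algebraMap_eq_pow_gcd {F E : Type*} [Field F] [Field E] [Algebra F E] {α : E}
    (hα : α ≠ 0) {m n : ℕ} {b a : F} (hb : algebraMap F E b = α ^ m)
    (ha : algebraMap F E a = α ^ n) : ∃ c : F, algebraMap F E c = α ^ m.gcd n := by
  refine ⟨b ^ m.gcdA n * a ^ m.gcdB n, ?_⟩
  rw [map_mul, map_zpow₀, map_zpow₀, hb, ha, ← zpow_natCast α (m.gcd n), Nat.gcd_eq_gcd_ab,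
    zpow_add₀ hα, zpow_mul, zpow_mul, zpow_natCast, zpow_natCast]

/-- A product of `F`-multiples of `α` is an `F`-multiple of a power of `α`. -/
theorem exists_prod_eq_algebraMap_mul_pow {F E : Type*} [Field F] [Field E] [Algebra F E] {α : E}
    {s : Multiset E} (hs : ∀ r ∈ s, ∃ c : F, r = algebraMap F E c * α) :
    ∃ c : F, s.prod = algebraMap F E c * α ^ s.card := by
  induction s using Multiset.induction_on with
  | empty => exact ⟨1, by simp⟩
  | cons r s ih =>
    obtain ⟨c, hc⟩ := ih fun r hr => hs r (Multiset.mem_cons_of_mem hr)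
    obtain ⟨e, he⟩ := hs r (Multiset.mem_cons_self r s)
    refine ⟨e * c, ?_⟩
    rw [Multiset.prod_cons, hc, he, Multiset.card_cons, map_mul]
    ring

/-- In the presence of a primitive `n`-th root of unity, `X ^ n - a` is irreducible as soon as `a`
is not a `k`-th power for any divisor `k ≠ 1` of `n`. -/
theorem X_pow_sub_C_irreducible_of_isPrimitiveRoot {F : Type*} [Field F] {n : ℕ} (hn : n ≠ 0)
    {ζ : F} (hζ : IsPrimitiveRoot ζ n) {a : F}
    (ha : ∀ k, k ∣ n → k ≠ 1 → ∀ b : F, b ^ k ≠ a) :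
    Irreducible (Polynomial.X ^ n - Polynomial.C a) := by
  rcases eq_or_ne n 1 with rfl | hn1
  · simpa using Polynomial.irreducible_X_sub_C a
  have ha0 : a ≠ 0 := fun h => ha n dvd_rfl hn1 0 (by rw [h, zero_pow hn])
  have hmonic : (Polynomial.X ^ n - Polynomial.C a).Monic := Polynomial.monic_X_pow_sub_C a hn
  have hdeg : (Polynomial.X ^ n - Polynomial.C a).natDegree = n := Polynomial.natDegree_X_pow_sub_C
  obtain ⟨q, hqm, hqi, hqd⟩ := Polynomial.exists_monic_irreducible_factor
    (Polynomial.X ^ n - Polynomial.C a) (Polynomial.not_isUnit_of_natDegree_pos _ (by omega))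
  have hqle : q.natDegree ≤ n := hdeg ▸ Polynomial.natDegree_le_of_dvd hqd hmonic.ne_zero
  rcases hqle.eq_or_lt with heq | hlt
  · rwa [Polynomial.eq_of_monic_of_dvd_of_natDegree_le hqm hmonic hqd (by omega)]
  exfalso
  obtain ⟨α, hα⟩ := IsAlgClosed.exists_pow_nat_eq (algebraMap F (AlgebraicClosure F) a)
    (Nat.pos_of_ne_zero hn)
  have hα0 : α ≠ 0 := by
    rintro rfl
    rw [zero_pow hn] at hα
    exact ha0 ((map_eq_zero _).1 hα.symm)
  have hroot : ∀ r ∈ (q.map (algebraMap F (AlgebraicClosure F))).roots,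
      ∃ c : F, r = algebraMap F (AlgebraicClosure F) c * α := by
    intro r hr
    have h1 := (Polynomial.mem_roots'.1 hr).2
    obtain ⟨g, hg⟩ := hqd
    have h2 : r ^ n = algebraMap F (AlgebraicClosure F) a := by
      have := congrArg (Polynomial.eval₂ (algebraMap F (AlgebraicClosure F)) r) hg
      rw [Polynomial.eval₂_mul, ← Polynomial.eval_map, ← Polynomial.eval_map, h1.eq_zero,
        zero_mul] at this
      simpa [sub_eq_zero] using this
    have : NeZero n := ⟨hn⟩
    obtain ⟨i, -, hi⟩ :=
      (hζ.map_of_injective (algebraMap F (AlgebraicClosure F)).injective).eq_pow_of_pow_eq_one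
      (ξ := r / α) (by rw [div_pow, h2, hα, div_self]; simpa using ha0)
    exact ⟨ζ ^ i, by rw [map_pow, hi, div_mul_cancel₀ _ hα0]⟩
  have hspl : (q.map (algebraMap F (AlgebraicClosure F))).Splits := IsAlgClosed.splits _
  obtain ⟨c, hc⟩ := exists_prod_eq_algebraMap_mul_pow hroot
  have hcard : (q.map (algebraMap F (AlgebraicClosure F))).roots.card = q.natDegree := by
    rw [← hspl.natDegree_eq_card_roots, Polynomial.natDegree_map]
  have hcoeff : algebraMap F (AlgebraicClosure F) (q.coeff 0) =
      (-1) ^ q.natDegree * (algebraMap F (AlgebraicClosure F) c * α ^ q.natDegree) := by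
    have := hspl.coeff_zero_eq_prod_roots_of_monic (hqm.map _)
    rwa [hc, hcard, Polynomial.coeff_map, Polynomial.natDegree_map] at this
  have hq0 : q.coeff 0 ≠ 0 := by
    intro h0
    obtain ⟨g, hg⟩ := hqd
    have := congrArg (Polynomial.coeff · 0) hg
    simp [Polynomial.mul_coeff_zero, h0, Polynomial.coeff_X_pow, hn.symm] at this
    exact ha0 this
  have hc0 : c ≠ 0 := by
    rintro rfl
    simp at hcoeff
    exact hq0 hcoeff
  obtain ⟨e, he⟩ := exists_algebraMap_eq_pow_gcd (F := F) hα0 (m := q.natDegree) (n := n)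
    (b := (-1) ^ q.natDegree * q.coeff 0 / c) (a := a) (by
      have : algebraMap F (AlgebraicClosure F) c ≠ 0 := by simpa using hc0
      rw [map_div₀, map_mul, hcoeff, map_pow, map_neg, map_one, ← mul_assoc, ← mul_pow]
      field_simp
      simp) hα.symm
  have hgn := Nat.gcd_dvd_right q.natDegree n
  refine ha (n / q.natDegree.gcd n) (Nat.div_dvd_of_dvd hgn) (fun h => ?_) e ?_
  · have h1 := Nat.gcd_le_left n hqi.natDegree_pos
    have h2 := Nat.div_mul_cancel hgn
    rw [h, one_mul] at h2
    omega
  · apply (algebraMap F (AlgebraicClosure F)).injective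
    rw [map_pow, he, ← pow_mul, Nat.mul_div_cancel' hgn, hα]

/-- A binomial `P X ^ n + Q` with coprime coefficients over a unique factorization domain
containing a primitive `n`-th root of unity is irreducible if `P` is not associated to a power. -/
theorem irreducible_C_mul_X_pow_add_C {R : Type*} [CommRing R] [IsDomain R]
    [UniqueFactorizationMonoid R] {n : ℕ} (hn : n ≠ 0) {ζ : R} (hζ : IsPrimitiveRoot ζ n)
    {P Q : R} (hP0 : P ≠ 0) (hPQ : IsRelPrime P Q)
    (hP : ∀ (S : R) (k : ℕ), 1 < k → ¬ Associated (S ^ k) P) :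
    Irreducible (Polynomial.C P * Polynomial.X ^ n + Polynomial.C Q) := by
  have hinj : Function.Injective (algebraMap R (FractionRing R)) :=
    IsFractionRing.injective R (FractionRing R)
  have hPF : algebraMap R (FractionRing R) P ≠ 0 := by simpa using hP0
  have hprim : (Polynomial.C P * Polynomial.X ^ n + Polynomial.C Q).IsPrimitive := by
    intro r hr
    rw [Polynomial.C_dvd_iff_dvd_coeff] at hr
    refine hPQ ?_ ?_
    · simpa [Polynomial.coeff_C, hn] using hr n
    · simpa [Polynomial.coeff_X_pow, hn.symm] using hr 0
  refine hprim.irreducible_of_irreducible_map_of_injective hinj ?_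
  have hmap : (Polynomial.C P * Polynomial.X ^ n + Polynomial.C Q).map
      (algebraMap R (FractionRing R)) =
      Polynomial.C (algebraMap R (FractionRing R) P) *
        (Polynomial.X ^ n -
          Polynomial.C (-(algebraMap R (FractionRing R) Q / algebraMap R (FractionRing R) P))) := by
    rw [mul_sub, ← Polynomial.C_mul, mul_neg, mul_div_cancel₀ _ hPF]
    simp
  rw [hmap, irreducible_isUnit_mul (Polynomial.isUnit_C.2 hPF.isUnit)]
  refine X_pow_sub_C_irreducible_of_isPrimitiveRoot hn (hζ.map_of_injective hinj) ?_
  intro k hk hk1 b hb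
  have hk0 : k ≠ 0 := fun h => hn (by simpa [h] using hk)
  obtain ⟨u, v, huv, rfl⟩ := IsFractionRing.exists_reduced_fraction (A := R) b
  have hv0 : algebraMap R (FractionRing R) v ≠ 0 := by simp
  have key : P * u ^ k = -(Q * (v : R) ^ k) := by
    apply hinj
    rw [IsFractionRing.mk'_eq_div, div_pow] at hb
    field_simp at hb
    simp only [map_mul, map_neg, map_pow]
    linear_combination hb
  refine hP v k (by omega) (associated_of_dvd_dvd ?_ ?_)
  · refine (IsRelPrime.pow huv.symm : IsRelPrime ((v : R) ^ k) (u ^ k)).dvd_of_dvd_mul_right ?_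
    exact key ▸ (dvd_neg.2 (dvd_mul_left _ _))
  · exact hPQ.dvd_of_dvd_mul_left (dvd_neg.1 (key ▸ dvd_mul_right _ _))

/-- The substitution `x_i ↦ x_i z`, where `z` is a new variable. -/
noncomputable def MvPolynomial.homogenizingHom (σ K : Type*) [CommRing K] :
    MvPolynomial σ K →ₐ[K] Polynomial (MvPolynomial σ K) :=
  aeval fun i => Polynomial.C (X i) * Polynomial.X

theorem MvPolynomial.eval_one_homogenizingHom {σ K : Type*} [CommRing K]
    (p : MvPolynomial σ K) : (homogenizingHom σ K p).eval 1 = p := by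
  induction p using MvPolynomial.induction_on with
  | C a => simp [homogenizingHom, Polynomial.algebraMap_apply, algebraMap_eq]
  | add p q hp hq => rw [map_add, Polynomial.eval_add, hp, hq]
  | mul_X p i hp =>
    rw [map_mul, Polynomial.eval_mul, hp]
    simp [homogenizingHom]

theorem MvPolynomial.IsHomogeneous.homogenizingHom_eq {σ K : Type*} [CommRing K]
    {p : MvPolynomial σ K} {d : ℕ} (hp : p.IsHomogeneous d) :
    homogenizingHom σ K p = Polynomial.C p * Polynomial.X ^ d := by
  conv_rhs => rw [p.as_sum, map_sum, Finset.sum_mul]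
  rw [homogenizingHom, aeval_def, eval₂_eq]
  refine Finset.sum_congr rfl fun m hm => ?_
  have hdeg : ∑ i ∈ m.support, m i = d := by
    simpa [Finsupp.weight_apply, Finsupp.sum] using hp (mem_support_iff.1 hm)
  rw [monomial_eq, Finsupp.prod, map_mul, map_prod, ← hdeg, ← Finset.prod_pow_eq_pow_sum]
  simp only [mul_pow, Finset.prod_mul_distrib, Polynomial.algebraMap_apply, algebraMap_eq,
    map_pow, mul_assoc]

/-- The sum of two coprime homogeneous polynomials of different degrees is irreducible, provided
the one of larger degree is not a power. -/
theorem MvPolynomial.IsHomogeneous.irreducible_add {σ K : Type*} [Field K] [IsAlgClosed K]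
    [CharZero K] {P Q : MvPolynomial σ K} {d e : ℕ} (hP : P.IsHomogeneous d)
    (hQ : Q.IsHomogeneous e) (hed : e < d) (hPQ : IsRelPrime P Q)
    (hpp : ¬ ∃ (S : MvPolynomial σ K) (k : ℕ), 1 < k ∧ P = S ^ k) :
    Irreducible (P + Q) := by
  have hP0 : P ≠ 0 := fun h => hpp ⟨0, 2, one_lt_two, by simpa using h⟩
  have hn : d - e ≠ 0 := by omega
  have : NeZero ((d - e : ℕ) : K) := ⟨by exact_mod_cast hn⟩
  obtain ⟨ζ, hζ⟩ := HasEnoughRootsOfUnity.exists_primitiveRoot K (d - e)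
  have hG : Prime (Polynomial.C P * Polynomial.X ^ (d - e) + Polynomial.C Q) := by
    refine (irreducible_C_mul_X_pow_add_C hn (hζ.map_of_injective (C_injective σ K)) hP0 hPQ
      fun S k hk ⟨w, hw⟩ => hpp ?_).prime
    obtain ⟨r, -, hr⟩ := isUnit_iff_eq_C_of_isReduced.1 w.isUnit
    obtain ⟨s, hs⟩ := IsAlgClosed.exists_pow_nat_eq r (zero_lt_one.trans hk)
    exact ⟨S * C s, k, hk, by rw [mul_pow, ← map_pow, hs, ← hr, hw]⟩
  set G := Polynomial.C P * Polynomial.X ^ (d - e) + Polynomial.C Q with hGdef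
  have hφ : homogenizingHom σ K (P + Q) = Polynomial.X ^ e * G := by
    rw [map_add, hP.homogenizingHom_eq, hQ.homogenizingHom_eq, hGdef]
    conv_lhs => rw [← Nat.sub_add_cancel hed.le]
    ring
  have unit_of_dvd : ∀ A B, P + Q = A * B → G ∣ homogenizingHom σ K A → IsUnit B := by
    rintro A B h ⟨H, hH⟩
    rw [h, map_mul, hH, mul_assoc, mul_comm (Polynomial.X ^ e)] at hφ
    have h1 := congrArg (Polynomial.eval 1) (mul_left_cancel₀ hG.ne_zero hφ)
    rw [Polynomial.eval_mul, eval_one_homogenizingHom, Polynomial.eval_pow, Polynomial.eval_X,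
      one_pow] at h1
    exact .of_mul_eq_one_right _ h1
  refine ⟨fun hu => hG.not_isUnit ?_, fun A B h => ?_⟩
  · have := hu.map (homogenizingHom σ K)
    rw [hφ] at this
    exact isUnit_of_mul_isUnit_right this
  · have hdvd : G ∣ homogenizingHom σ K A * homogenizingHom σ K B := by
      rw [← map_mul, ← h, hφ]
      exact dvd_mul_left _ _
    rcases hG.dvd_or_dvd hdvd with hA | hB
    · exact .inr (unit_of_dvd A B h hA)
    · exact .inl (unit_of_dvd B A (h.trans (mul_comm A B)) hB)

/-- If `P ∈ K[x,y]` is homogeneous of degree `d > 1`, not a pure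
power, and `Q = x^i y^j` has degree `i + j < d` and is relatively prime to `P`,
then `P + λ* x^i y^j` is irreducible for all but at most `deg(P)² − 1` values
`λ* ∈ K`. -/
theorem irreducible_homogeneous_plus_monomial
    {K : Type*} [Field K] [IsAlgClosed K] [CharZero K]
    (P : MvPolynomial (Fin 2) K) (d : ℕ) (hd : 1 < d)
    (hhom : P.IsHomogeneous d)
    (hpp : ¬ ∃ (S : MvPolynomial (Fin 2) K) (k : ℕ), 1 < k ∧ P = S ^ k)
    (i j : ℕ) (hij : i + j < d)
    (hcop : IsRelPrime P (X 0 ^ i * X 1 ^ j)) :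
    ∃ s : Finset K, s.card ≤ P.totalDegree ^ 2 - 1 ∧
      ∀ t : K, t ∉ s → Irreducible (P + C t * (X 0 ^ i * X 1 ^ j)) := by
  refine ⟨{0}, ?_, fun t ht => ?_⟩
  · have hP0 : P ≠ 0 := fun h => hpp ⟨0, 2, one_lt_two, by simpa using h⟩
    rw [Finset.card_singleton, hhom.totalDegree hP0]
    have : 2 ^ 2 ≤ d ^ 2 := Nat.pow_le_pow_left hd 2
    omega
  · have ht0 : t ≠ 0 := by simpa using ht
    have hu : IsUnit (C t : MvPolynomial (Fin 2) K) := ht0.isUnit.map C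
    refine hhom.irreducible_add (e := i + j) ?_ hij ((isRelPrime_mul_unit_left_right hu).2 hcop)
      hpp
    exact (((isHomogeneous_X_pow 0 i).mul (isHomogeneous_X_pow 1 j)).C_mul t)
end

section
/- Let K be an algebraically closed field of characteristic 0 and P ∈ K[x_1,...,x_n] a polynomial not lying in K[x_1] and not divisible by x_1. Then P(x_1,...,x_n) + λ*·x_1 is irreducible in K[x_1,...,x_n] for all but at most deg(P)^2 − 1 values of λ* ∈ K. -/
open MvPolynomial

/-- A derivation of a domain extends to its field of fractions. -/
theorem exists_derivation_fractionRing {K R L : Type*} [CommRing K] [CommRing R] [IsDomain R]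
    [Field L] [Algebra K R] [Algebra K L] [Algebra R L] [IsScalarTower K R L]
    [IsFractionRing R L] (D : Derivation K R R) :
    ∃ D' : Derivation K L L, ∀ r, D' (algebraMap R L r) = algebraMap R L (D r) := by
  have := KaehlerDifferential.isLocalizedModule_map K R L (nonZeroDivisors R)
  let g : Ω[R⁄K] →ₗ[R] L := ((Algebra.linearMap R L).compDer D).liftKaehlerDifferential
  have hu : ∀ s : nonZeroDivisors R, IsUnit ((algebraMap R (Module.End R L)) s) := fun s =>
    (IsLocalizedModule.map_units (Algebra.linearMap R L) s)
  let g' := IsLocalizedModule.lift (nonZeroDivisors R) (KaehlerDifferential.map K K R L) g hu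
  let g'' := LinearMap.extendScalarsOfIsLocalization (nonZeroDivisors R) L g'
  refine ⟨g''.compDer (KaehlerDifferential.D K L), fun r => ?_⟩
  have h1 : g' (KaehlerDifferential.map K K R L (KaehlerDifferential.D K R r)) =
      g (KaehlerDifferential.D K R r) := IsLocalizedModule.lift_apply _ _ _ _ _
  rw [KaehlerDifferential.map_D] at h1
  simpa [g''] using h1.trans (Derivation.liftKaehlerDifferential_comp_D _ _)

/-- A derivation vanishing on a transcendence basis vanishes, in characteristic zero. -/
theorem IsTranscendenceBasis.derivation_eq_zero {ι K L : Type*} [Field K] [Field L] [CharZero K]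
    [Algebra K L] {v : ι → L} (hv : IsTranscendenceBasis K v) (D : Derivation K L L)
    (h : ∀ i, D (v i) = 0) : D = 0 := by
  let F := IntermediateField.adjoin K (Set.range v)
  have halg : Algebra.IsAlgebraic F L := hv.isAlgebraic_field
  have hF : ∀ f ∈ F, D f = 0 := by
    intro f hf
    induction hf using IntermediateField.adjoin_induction with
    | mem x hx => obtain ⟨i, rfl⟩ := hx; exact h i
    | algebraMap x => simp
    | add x y _ _ hx hy => simp [hx, hy]
    | inv x _ hx => simp [hx, Derivation.leibniz_inv]
    | mul x y _ _ hx hy => simp [hx, hy]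
  let DF : Derivation F L L := Derivation.mk'
    { toFun := D
      map_add' := map_add D
      map_smul' := fun f z => by
        simp [Algebra.smul_def, Derivation.leibniz, hF _ (f.2)] }
    (fun a b => by simp)
  have := charZero_of_injective_algebraMap (algebraMap K F).injective
  ext z
  have hz : IsIntegral F z := (halg.isAlgebraic z).isIntegral
  have h1 := DF.map_aeval (minpoly F z) z
  rw [minpoly.aeval, map_zero] at h1
  have h2 := (minpoly.irreducible hz).separable.aeval_derivative_ne_zero (minpoly.aeval F z)
  exact (smul_eq_zero.1 h1.symm).resolve_left h2

theorem isAlgebraic_adjoin_of_derivation_eq_zero {K L : Type*} [Field K] [Field L] [CharZero K]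
    [Algebra K L] (htr : Algebra.trdeg K L ≤ 2) (D : Derivation K L L) (hD : D ≠ 0) {a h : L}
    (hh : Transcendental K h) (hDa : D a = 0) (hDh : D h = 0) :
    IsAlgebraic (Algebra.adjoin K {h}) a := by
  by_contra hcon
  have h1 : AlgebraicIndependent K (fun _ : Unit => h) := by
    rw [algebraicIndependent_unique_type_iff]; exact hh
  have h2 := (h1.option_iff_transcendental a).2 (by rw [Set.range_const]; exact hcon)
  have h3 := h2.isTranscendenceBasis_of_lift_trdeg_le_of_finite (by simpa using htr)
  refine hD (h3.derivation_eq_zero D ?_)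
  rintro (_ | _) <;> simp [hDa, hDh]

theorem MvPolynomial.trdeg_fractionRing_fin_two {K : Type*} [Field K] :
    Algebra.trdeg K (FractionRing (MvPolynomial (Fin 2) K)) ≤ 2 := by
  have h := trdeg_add_eq K (MvPolynomial (Fin 2) K) (A := FractionRing (MvPolynomial (Fin 2) K))
  rw [MvPolynomial.trdeg_of_isDomain] at h
  rw [← h]
  have : Algebra.IsAlgebraic (MvPolynomial (Fin 2) K) (FractionRing (MvPolynomial (Fin 2) K)) :=
    IsLocalization.isAlgebraic _ (nonZeroDivisors _)
  rw [trdeg_eq_zero_iff.2 this]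
  simp

namespace MvPolynomial

theorem totalDegree_pderiv_lt {σ R : Type*} [CommSemiring R] {p : MvPolynomial σ R} {i : σ}
    (h : pderiv i p ≠ 0) : (pderiv i p).totalDegree < p.totalDegree := by
  have key : ∀ m ∈ (pderiv i p).support, (m.sum fun _ e => e) < p.totalDegree := by
    intro m hm
    have hm' : m + Finsupp.single i 1 ∈ p.support := by
      rw [mem_support_iff, coeff_pderiv] at hm
      exact mem_support_iff.2 (left_ne_zero_of_mul hm)
    have := le_totalDegree hm'
    rw [Finsupp.sum_add_index' (by simp) (by simp), Finsupp.sum_single_index rfl] at this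
    omega
  obtain ⟨m, hm⟩ := support_nonempty.2 h
  exact (Finset.sup_lt_iff (lt_of_le_of_lt (Nat.zero_le _) (key m hm))).2 key

theorem pderiv_ne_zero_of_mem_support {σ R : Type*} [CommSemiring R] [NoZeroDivisors R]
    [CharZero R] {p : MvPolynomial σ R} {m : σ →₀ ℕ} (hm : m ∈ p.support) {i : σ}
    (hi : m i ≠ 0) : pderiv i p ≠ 0 := by
  intro h
  have hle : Finsupp.single i 1 ≤ m := by
    rw [Finsupp.single_le_iff]; omega
  have h1 := congrArg (coeff (m - Finsupp.single i 1)) h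
  rw [coeff_pderiv, tsub_add_cancel_of_le hle, coeff_zero] at h1
  exact (mul_ne_zero (mem_support_iff.1 hm) (Nat.cast_add_one_ne_zero _)) h1

theorem exists_pderiv_ne_zero {σ R : Type*} [CommSemiring R] [NoZeroDivisors R] [CharZero R]
    {p : MvPolynomial σ R} (h : p.totalDegree ≠ 0) : ∃ i, pderiv i p ≠ 0 := by
  by_contra! hcon
  exact h ((totalDegree_eq_zero_iff _ p).2 fun m hm i =>
    not_not.1 fun hmi => pderiv_ne_zero_of_mem_support hm hmi (hcon i))

theorem isUnit_iff_totalDegree_eq_zero {σ K : Type*} [Field K] {p : MvPolynomial σ K}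
    (hp : p ≠ 0) : IsUnit p ↔ p.totalDegree = 0 := by
  rw [isUnit_iff_totalDegree_of_isReduced, isUnit_iff_ne_zero, and_iff_right_iff_imp]
  intro h hc
  rw [totalDegree_eq_zero_iff_eq_C.1 h, hc, C_0] at hp
  exact hp rfl

theorem exists_not_dvd_pderiv {σ K : Type*} [Field K] [CharZero K] {p : MvPolynomial σ K}
    (hp : Irreducible p) : ∃ i, ¬ p ∣ pderiv i p := by
  obtain ⟨i, hi⟩ := exists_pderiv_ne_zero
    (fun h => hp.not_isUnit ((isUnit_iff_totalDegree_eq_zero hp.ne_zero).2 h))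
  exact ⟨i, fun hdvd => (totalDegree_le_of_dvd_of_isDomain hdvd hi).not_gt
    (totalDegree_pderiv_lt hi)⟩

/-- The coefficient of a product at a vertex of the Newton polygon. -/
theorem coeff_mul_of_forall_le {σ R Γ : Type*} [CommSemiring R] [AddCommMonoid Γ] [LinearOrder Γ]
    [IsOrderedCancelAddMonoid Γ] (κ : (σ →₀ ℕ) →+ Γ) (hκ : Function.Injective κ)
    {p q : MvPolynomial σ R} {a b : σ →₀ ℕ} (hp : ∀ m, coeff m p ≠ 0 → κ a ≤ κ m)
    (hq : ∀ m, coeff m q ≠ 0 → κ b ≤ κ m) : coeff (a + b) (p * q) = coeff a p * coeff b q := by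
  classical
  rw [coeff_mul]
  refine Finset.sum_eq_single (a, b) (fun x hx hne => ?_) (by simp)
  by_contra hcon
  have h1 := hp _ (left_ne_zero_of_mul hcon)
  have h2 := hq _ (right_ne_zero_of_mul hcon)
  have h3 : κ x.1 + κ x.2 = κ a + κ b := by
    rw [← map_add, ← map_add, Finset.HasAntidiagonal.mem_antidiagonal.1 hx]
  have h4 : κ a = κ x.1 := by
    by_contra h
    exact (add_lt_add_of_lt_of_le (lt_of_le_of_ne h1 h) h2).ne h3.symm
  have h5 : κ b = κ x.2 := by rw [← h4] at h3; exact (add_left_cancel h3).symm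
  exact hne (Prod.ext (hκ h4).symm (hκ h5).symm)

theorem coeff_X_mul_pderiv {σ R : Type*} [CommSemiring R] (i : σ) (p : MvPolynomial σ R)
    (m : σ →₀ ℕ) : coeff m (X i * pderiv i p) = m i * coeff m p := by
  classical
  rw [coeff_X_mul']
  split_ifs with h <;> rw [Finsupp.mem_support_iff] at h
  · rw [coeff_pderiv, tsub_add_cancel_of_le
      (by rw [Finsupp.single_le_iff]; omega), mul_comm]
    congr 1
    simp only [Finsupp.coe_tsub, Pi.sub_apply, Finsupp.single_eq_same]
    rw [← Nat.cast_add_one]; congr 1; omega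
  · simp [not_not.1 h]

/-- The additive map `(i, j) ↦ (β i - α j, ε j)`, with values ordered lexicographically. -/
def lexWeight (α β ε : ℤ) : (Fin 2 →₀ ℕ) →+ ℤ ×ₗ ℤ where
  toFun m := toLex (m 0 * β - m 1 * α, ε * m 1)
  map_zero' := by simp
  map_add' m m' := by
    rw [← toLex_add, Prod.mk_add_mk]
    simp only [Finsupp.coe_add, Pi.add_apply, Nat.cast_add]
    congr 2 <;> ring

theorem lexWeight_le {α β ε : ℤ} {m m' : Fin 2 →₀ ℕ} : lexWeight α β ε m ≤ lexWeight α β ε m' ↔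
    (m 0 * β - m 1 * α < m' 0 * β - m' 1 * α ∨
      m 0 * β - m 1 * α = m' 0 * β - m' 1 * α ∧ ε * m 1 ≤ ε * m' 1) :=
  Prod.Lex.toLex_le_toLex

theorem lexWeight_injective {α β ε : ℤ} (hβ : β ≠ 0) (hε : ε ≠ 0) :
    Function.Injective (lexWeight α β ε) := by
  intro m m' h
  have h' := congrArg ofLex h
  simp only [lexWeight, AddMonoidHom.coe_mk, ZeroHom.coe_mk, ofLex_toLex, Prod.mk.injEq,
    mul_eq_mul_left_iff, hε, or_false, Nat.cast_inj] at h'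
  obtain ⟨h0, h1⟩ := h'
  rw [h1] at h0
  have h2 : (m 0 : ℤ) = m' 0 := mul_right_cancel₀ hβ (by linarith)
  ext i
  fin_cases i
  · exact_mod_cast h2
  · exact h1

variable {K : Type*} [Field K]

/-- The derivation `X₀² (dh ∧ ·)` of `K[X₀, X₁]` attached to the function `h = P / X₀`. -/
noncomputable def pencilDerivation (P : MvPolynomial (Fin 2) K) :
    Derivation K (MvPolynomial (Fin 2) K) (MvPolynomial (Fin 2) K) :=
  (X 0 * pderiv 0 P - P) • pderiv 1 - (X 0 * pderiv 1 P) • pderiv 0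

theorem pencilDerivation_apply (P Z : MvPolynomial (Fin 2) K) : pencilDerivation P Z =
    (X 0 * pderiv 0 P - P) * pderiv 1 Z - X 0 * pderiv 1 P * pderiv 0 Z := by
  simp [pencilDerivation]

theorem pencilDerivation_pencil (P : MvPolynomial (Fin 2) K) (t : K) :
    pencilDerivation P (P + C t * X 0) = -pderiv 1 P * (P + C t * X 0) := by
  simp only [pencilDerivation_apply, map_add, pderiv_C_mul, pderiv_X_self,
    pderiv_X_of_ne (show (0 : Fin 2) ≠ 1 by decide)]
  ring

theorem pencilDerivation_X (P : MvPolynomial (Fin 2) K) :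
    pencilDerivation P (X 0) = -pderiv 1 P * X 0 := by
  simp only [pencilDerivation_apply, pderiv_X_self,
    pderiv_X_of_ne (show (0 : Fin 2) ≠ 1 by decide)]
  ring

theorem vertex_relation [CharZero K] {P Z : MvPolynomial (Fin 2) K} {N : ℕ}
    (hZ : pencilDerivation P Z = -(N * pderiv 1 P) * Z) {Γ : Type*} [AddCommMonoid Γ]
    [LinearOrder Γ] [IsOrderedCancelAddMonoid Γ] (κ : (Fin 2 →₀ ℕ) →+ Γ)
    (hκ : Function.Injective κ) {a b : Fin 2 →₀ ℕ} (ha : a ∈ P.support) (hb : b ∈ Z.support)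
    (hPa : ∀ m ∈ P.support, κ a ≤ κ m) (hZb : ∀ m ∈ Z.support, κ b ≤ κ m) :
    ((a 0 : ℤ) - 1) * b 1 - a 1 * b 0 + N * a 1 = 0 := by
  simp only [mem_support_iff] at *
  have hid : (X 0 * pderiv 0 P - P) * (X 1 * pderiv 1 Z) - (X 1 * pderiv 1 P) * (X 0 * pderiv 0 Z)
      + C (N : K) * ((X 1 * pderiv 1 P) * Z) = 0 := by
    rw [pencilDerivation_apply] at hZ
    rw [show (C (N : K) : MvPolynomial (Fin 2) K) = N by simp]
    linear_combination X 1 * hZ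
  have hE : ∀ (i : Fin 2) (p : MvPolynomial (Fin 2) K) m, coeff m (X i * pderiv i p) ≠ 0 →
      coeff m p ≠ 0 := fun i p m h => by
    rw [coeff_X_mul_pderiv] at h
    exact right_ne_zero_of_mul h
  have h := congrArg (coeff (a + b)) hid
  rw [coeff_add, coeff_sub, coeff_C_mul, coeff_zero,
    coeff_mul_of_forall_le κ hκ (a := a) (b := b) _ (fun m hm => hZb m (hE _ _ _ hm)),
    coeff_mul_of_forall_le κ hκ (fun m hm => hPa m (hE _ _ _ hm))
      (fun m hm => hZb m (hE _ _ _ hm)),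
    coeff_mul_of_forall_le κ hκ (fun m hm => hPa m (hE _ _ _ hm)) hZb] at h
  · simp only [coeff_sub, coeff_X_mul_pderiv] at h
    have h2 : (((((a 0 : ℤ) - 1) * b 1 - a 1 * b 0 + N * a 1 : ℤ) : K)) *
        (coeff a P * coeff b Z) = 0 := by
      push_cast
      linear_combination h
    exact_mod_cast (mul_eq_zero.1 h2).resolve_right (mul_ne_zero ha hb)
  · intro m hm
    refine hPa m fun h0 => hm ?_
    rw [coeff_sub, coeff_X_mul_pderiv, h0]
    simp

theorem exists_coeff_single_ne_zero [CharZero K] {P Z : MvPolynomial (Fin 2) K}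
    (hP0 : coeff 0 P ≠ 0) (hP1 : pderiv 1 P ≠ 0) (hZ0 : Z ≠ 0) {N : ℕ}
    (hZ : pencilDerivation P Z = -(N * pderiv 1 P) * Z) :
    ∃ s ≤ N, coeff (Finsupp.single 0 s) Z ≠ 0 := by
  obtain ⟨m₀, hm₀, hmin⟩ := Finset.exists_min_image
      (P.support.filter fun m : Fin 2 →₀ ℕ => m 1 ≠ 0) (fun m => (m 0 : ℚ) / m 1) (by
    obtain ⟨m, hm⟩ := support_nonempty.2 hP1
    rw [mem_support_iff, coeff_pderiv] at hm
    exact ⟨_, Finset.mem_filter.2 ⟨mem_support_iff.2 (left_ne_zero_of_mul hm), by simp⟩⟩)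
  rw [Finset.mem_filter] at hm₀
  obtain ⟨hm₀P, hm₀1⟩ := hm₀
  obtain ⟨α, hα⟩ : ∃ α : ℤ, α = m₀ 0 := ⟨_, rfl⟩
  obtain ⟨β, hβ⟩ : ∃ β : ℤ, β = m₀ 1 := ⟨_, rfl⟩
  have hβ0 : 0 < β := by omega
  have hwt : ∀ m ∈ P.support, 0 ≤ m 0 * β - m 1 * α := by
    intro m hm
    by_cases h : m 1 = 0
    · rw [h]; simp; positivity
    · have h1 := hmin m (Finset.mem_filter.2 ⟨hm, h⟩)
      rw [div_le_div_iff₀ (by positivity) (by positivity)] at h1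
      have h2 : (m₀ 0 : ℤ) * m 1 ≤ m 0 * m₀ 1 := by exact_mod_cast h1
      rw [hα, hβ]; linarith
  obtain ⟨b, hb, hbmin⟩ := Finset.exists_min_image Z.support (lexWeight α β 1)
    (support_nonempty.2 hZ0)
  obtain ⟨b', hb', hbmin'⟩ := Finset.exists_min_image Z.support (lexWeight α β (-1))
    (support_nonempty.2 hZ0)
  obtain ⟨a, ha, hamin⟩ := Finset.exists_min_image P.support (lexWeight α β (-1)) ⟨_, hm₀P⟩
  have h1 := vertex_relation hZ _ (lexWeight_injective hβ0.ne' one_ne_zero)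
    (mem_support_iff.2 hP0) hb (fun m hm => lexWeight_le.2 (by
      have := hwt m hm
      simp only [Finsupp.coe_zero, Pi.zero_apply, Nat.cast_zero]
      rcases this.lt_or_eq with h | h
      · left; simpa using h
      · right; exact ⟨by simpa using h, by simp⟩)) hbmin
  have hb1 : b 1 = 0 := by simpa using h1
  have h2 := vertex_relation hZ _ (lexWeight_injective hβ0.ne' (by decide)) ha hb' hamin hbmin'
  have h3 := lexWeight_le.1 (hamin m₀ hm₀P)
  have h4 := lexWeight_le.1 (hbmin b' hb')
  have h5 := lexWeight_le.1 (hbmin' b hb)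
  have h6 := hwt a ha
  rw [← hα, ← hβ, show α * β - β * α = 0 by ring] at h3
  have h7 : (a 0 : ℤ) * β - a 1 * α = 0 := by omega
  have h8 : β ≤ a 1 := by omega
  have h9 : (b 0 : ℤ) * β = b' 0 * β - b' 1 * α := by
    rw [hb1] at h4 h5
    simp only [Nat.cast_zero, zero_mul, sub_zero] at h4 h5
    omega
  have h10 : β * b' 1 = a 1 * ((N - b 0) * β) := by
    linear_combination (-β) * h2 + (b' 1 : ℤ) * h7 + (a 1 : ℤ) * h9
  have h11 : (b 0 : ℤ) ≤ N := by
    by_contra hlt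
    push Not at hlt
    have : (a 1 : ℤ) * (((N : ℤ) - b 0) * β) < 0 :=
      mul_neg_of_pos_of_neg (by omega) (mul_neg_of_neg_of_pos (by omega) hβ0)
    have : 0 ≤ β * b' 1 := by positivity
    omega
  refine ⟨b 0, by exact_mod_cast h11, ?_⟩
  have : Finsupp.single 0 (b 0) = b := by
    ext i; fin_cases i <;> simp [hb1]
  rw [this]
  exact mem_support_iff.1 hb

/-- The homogeneous forms of degree `N` in `P` and `X₀`. -/
noncomputable def pencilForms (P : MvPolynomial (Fin 2) K) (N : ℕ) :
    Submodule K (MvPolynomial (Fin 2) K) :=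
  Submodule.span K {g | ∃ i j, i + j = N ∧ g = P ^ i * X 0 ^ j}

theorem pow_mul_X_pow_mem_pencilForms (P : MvPolynomial (Fin 2) K) {i j N : ℕ} (h : i + j = N) :
    P ^ i * X 0 ^ j ∈ pencilForms P N :=
  Submodule.subset_span ⟨i, j, h, rfl⟩

theorem C_mul_mem_pencilForms {P Q : MvPolynomial (Fin 2) K} {N : ℕ} (h : Q ∈ pencilForms P N)
    (c : K) : C c * Q ∈ pencilForms P N := by
  rw [C_mul']; exact Submodule.smul_mem _ _ h

theorem eq_C_of_mem_pencilForms_zero {P Q : MvPolynomial (Fin 2) K} (h : Q ∈ pencilForms P 0) :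
    ∃ c, Q = C c := by
  induction h using Submodule.span_induction with
  | mem x hx =>
    obtain ⟨i, j, hij, rfl⟩ := hx
    obtain ⟨rfl, rfl⟩ := Nat.add_eq_zero_iff.1 hij
    exact ⟨1, by simp⟩
  | zero => exact ⟨0, by simp⟩
  | add x y _ _ hx hy =>
    obtain ⟨c, rfl⟩ := hx
    obtain ⟨c', rfl⟩ := hy
    exact ⟨c + c', by simp⟩
  | smul a x _ hx =>
    obtain ⟨c, rfl⟩ := hx
    exact ⟨a * c, by simp [C_mul']⟩

/-- Division of forms in `P` and `X₀` by the linear form `P + t X₀`. -/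
theorem exists_eq_mul_add_of_mem_pencilForms {P Q : MvPolynomial (Fin 2) K} {N : ℕ}
    (h : Q ∈ pencilForms P (N + 1)) (t : K) :
    ∃ Q' ∈ pencilForms P N, ∃ c, Q = (P + C t * X 0) * Q' + C c * X 0 ^ (N + 1) := by
  induction h using Submodule.span_induction with
  | mem x hx =>
    obtain ⟨i, j, hij, rfl⟩ := hx
    induction i generalizing j with
    | zero => exact ⟨0, zero_mem _, 1, by rw [← hij]; simp⟩
    | succ i ih =>
      obtain ⟨Q', hQ', c, h⟩ := ih (j + 1) (by omega)
      refine ⟨P ^ i * X 0 ^ j - C t * Q', sub_mem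
        (pow_mul_X_pow_mem_pencilForms P (by omega)) (C_mul_mem_pencilForms hQ' t), -(t * c), ?_⟩
      simp only [map_neg, map_mul]
      linear_combination (-C t) * h
  | zero => exact ⟨0, zero_mem _, 0, by simp⟩
  | add x y _ _ hx hy =>
    obtain ⟨Q₁, h₁, c₁, e₁⟩ := hx
    obtain ⟨Q₂, h₂, c₂, e₂⟩ := hy
    exact ⟨Q₁ + Q₂, add_mem h₁ h₂, c₁ + c₂, by rw [e₁, e₂, C_add]; ring⟩
  | smul a x _ hx =>
    obtain ⟨Q₁, h₁, c₁, e₁⟩ := hx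
    exact ⟨C a * Q₁, C_mul_mem_pencilForms h₁ a, a * c₁, by rw [smul_eq_C_mul, e₁, C_mul]; ring⟩

theorem pencilDerivation_of_mem_pencilForms {P Q : MvPolynomial (Fin 2) K} {N : ℕ}
    (h : Q ∈ pencilForms P N) : pencilDerivation P Q = -(N * pderiv 1 P) * Q := by
  induction h using Submodule.span_induction with
  | mem x hx =>
    obtain ⟨i, j, rfl, rfl⟩ := hx
    have hP : pencilDerivation P P = -pderiv 1 P * P := by
      simpa using pencilDerivation_pencil P 0
    rw [Derivation.leibniz, Derivation.leibniz_pow, Derivation.leibniz_pow, hP,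
      pencilDerivation_X]
    simp only [smul_eq_mul, nsmul_eq_mul, Nat.cast_add]
    have key : ∀ (p : MvPolynomial (Fin 2) K) (k : ℕ), (k : MvPolynomial (Fin 2) K) *
        (p ^ (k - 1) * p) = k * p ^ k := by
      intro p k
      cases k with
      | zero => simp
      | succ k => rw [Nat.add_sub_cancel, pow_succ]
    linear_combination (-P ^ i * pderiv 1 P) * key (X 0) j - (X 0 ^ j * pderiv 1 P) * key P i
  | zero => simp
  | add x y _ _ hx hy => rw [map_add, hx, hy]; ring
  | smul a x _ hx => rw [Derivation.map_smul, hx, smul_eq_C_mul, smul_eq_C_mul]; ring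

/-- Every Darboux polynomial with cofactor `-N ∂₁P` is a form of degree `N` in `P` and `X₀`. -/
theorem mem_pencilForms_of_pencilDerivation [CharZero K] {P Z : MvPolynomial (Fin 2) K}
    (hP0 : coeff 0 P ≠ 0) (hP1 : pderiv 1 P ≠ 0) {N : ℕ}
    (hZ : pencilDerivation P Z = -(N * pderiv 1 P) * Z) : Z ∈ pencilForms P N := by
  have key : ∀ k ≤ N + 1, ∃ Z' ∈ pencilForms P N, ∀ s < k,
      coeff (Finsupp.single 0 s) (Z - Z') = 0 := by
    intro k
    induction k with
    | zero => exact fun _ => ⟨0, zero_mem _, by simp⟩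
    | succ k ih =>
      intro hk
      obtain ⟨Z', hZ', h⟩ := ih (by omega)
      set c := coeff (Finsupp.single 0 k) (Z - Z') / coeff 0 P ^ (N - k) with hc
      refine ⟨Z' + C c * (P ^ (N - k) * X 0 ^ k), add_mem hZ'
        (C_mul_mem_pencilForms (pow_mul_X_pow_mem_pencilForms P (by omega)) _), fun s hs => ?_⟩
      rw [← sub_sub, coeff_sub, coeff_C_mul, X_pow_eq_monomial, coeff_mul_monomial']
      rcases Nat.lt_succ_iff_lt_or_eq.1 hs with hs | rfl
      · rw [h s hs, if_neg (by rw [Finsupp.single_le_iff]; simpa using hs)]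
        simp
      · rw [if_pos le_rfl, tsub_self, ← constantCoeff_eq, map_pow, constantCoeff_eq, mul_one,
          hc, div_mul_cancel₀ _ (pow_ne_zero _ hP0), sub_self]
  obtain ⟨Z', hZ', h⟩ := key (N + 1) le_rfl
  suffices Z - Z' = 0 by rwa [sub_eq_zero.1 this]
  by_contra hne
  obtain ⟨s, hs, hs'⟩ := exists_coeff_single_ne_zero hP0 hP1 hne (N := N) (by
    rw [map_sub, hZ, pencilDerivation_of_mem_pencilForms hZ']; ring)
  exact hs' (h s (by omega))

theorem exists_mem_pencilForms_of_mem_adjoin {L : Type*} [Field L] [Algebra K L]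
    [Algebra (MvPolynomial (Fin 2) K) L] [IsScalarTower K (MvPolynomial (Fin 2) K) L]
    [FaithfulSMul (MvPolynomial (Fin 2) K) L]
    {P : MvPolynomial (Fin 2) K} {s : L}
    (hs : s ∈ Algebra.adjoin K
      {algebraMap (MvPolynomial (Fin 2) K) L P / algebraMap (MvPolynomial (Fin 2) K) L (X 0)}) :
    ∃ N₀, ∀ N ≥ N₀, ∃ g ∈ pencilForms P N,
      algebraMap _ L g = algebraMap (MvPolynomial (Fin 2) K) L (X 0) ^ N * s := by
  rw [Algebra.adjoin_singleton_eq_range_aeval] at hs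
  obtain ⟨p, rfl⟩ := hs
  have hx : algebraMap (MvPolynomial (Fin 2) K) L (X 0) ≠ 0 := by
    rw [Ne, FaithfulSMul.algebraMap_eq_zero_iff]; exact X_ne_zero 0
  refine ⟨p.natDegree, fun N hN => ⟨∑ i ∈ Finset.range (p.natDegree + 1),
    p.coeff i • (P ^ i * X 0 ^ (N - i)), Submodule.sum_mem _ fun i hi => Submodule.smul_mem _ _
    (pow_mul_X_pow_mem_pencilForms P (by have := Finset.mem_range.1 hi; omega)), ?_⟩⟩
  simp only [AlgHom.toRingHom_eq_coe, RingHom.coe_coe]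
  rw [Polynomial.aeval_eq_sum_range, map_sum, Finset.mul_sum]
  refine Finset.sum_congr rfl fun i hi => ?_
  have hsmul : ∀ (c : K) (y : MvPolynomial (Fin 2) K), algebraMap (MvPolynomial (Fin 2) K) L
      (c • y) = c • algebraMap _ L y := map_smul (IsScalarTower.toAlgHom K _ L)
  rw [hsmul, mul_smul_comm, map_mul, map_pow, map_pow, div_pow,
    pow_sub₀ _ hx (by have := Finset.mem_range.1 hi; omega)]
  congr 1
  field_simp

/-- The rational function `P / X₀` is not constant. -/
theorem transcendental_div_X [IsAlgClosed K] {L : Type*} [Field L] [Algebra K L]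
    [Algebra (MvPolynomial (Fin 2) K) L] [IsScalarTower K (MvPolynomial (Fin 2) K) L]
    [FaithfulSMul (MvPolynomial (Fin 2) K) L]
    {P : MvPolynomial (Fin 2) K} (hP0 : coeff 0 P ≠ 0) : Transcendental K
      (algebraMap (MvPolynomial (Fin 2) K) L P / algebraMap (MvPolynomial (Fin 2) K) L (X 0)) := by
  intro halg
  obtain ⟨c, hc⟩ := minpoly.mem_range_of_degree_eq_one K _
    (IsAlgClosed.degree_eq_one_of_irreducible K (minpoly.irreducible halg.isIntegral))
  have hx : algebraMap (MvPolynomial (Fin 2) K) L (X 0) ≠ 0 := by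
    rw [Ne, FaithfulSMul.algebraMap_eq_zero_iff]; exact X_ne_zero 0
  rw [eq_div_iff hx, IsScalarTower.algebraMap_apply K (MvPolynomial (Fin 2) K) L, ← map_mul] at hc
  have h := FaithfulSMul.algebraMap_injective _ _ hc
  rw [← h, algebraMap_eq, coeff_C_mul, coeff_zero_X, mul_zero] at hP0
  exact hP0 rfl

/-- A rational function annihilated by the derivation of the pencil is a quotient of forms
in `P` and `X₀`. -/
theorem exists_pencilForms_mul_eq [IsAlgClosed K] [CharZero K] {L : Type*} [Field L] [Algebra K L]
    [Algebra (MvPolynomial (Fin 2) K) L] [IsScalarTower K (MvPolynomial (Fin 2) K) L]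
    [IsFractionRing (MvPolynomial (Fin 2) K) L] (htr : Algebra.trdeg K L ≤ 2)
    {P : MvPolynomial (Fin 2) K} (hP0 : coeff 0 P ≠ 0) (hP1 : pderiv 1 P ≠ 0)
    (D : Derivation K L L)
    (hD : ∀ r, D (algebraMap (MvPolynomial (Fin 2) K) L r) =
      algebraMap (MvPolynomial (Fin 2) K) L (pencilDerivation P r))
    {a : L} (ha : D a = 0) : ∃ N, ∃ Q ∈ pencilForms P N, ∃ Z ∈ pencilForms P N,
      Q ≠ 0 ∧ algebraMap _ L Q * a = algebraMap _ L Z := by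
  have hinj := IsFractionRing.injective (MvPolynomial (Fin 2) K) L
  have hx : algebraMap (MvPolynomial (Fin 2) K) L (X 0) ≠ 0 := by
    rw [Ne, FaithfulSMul.algebraMap_eq_zero_iff]; exact X_ne_zero 0
  have hDX : D (algebraMap (MvPolynomial (Fin 2) K) L (X 0)) ≠ 0 := by
    rw [hD, pencilDerivation_X, Ne, FaithfulSMul.algebraMap_eq_zero_iff]
    exact mul_ne_zero (neg_ne_zero.2 hP1) (X_ne_zero 0)
  have hDP : pencilDerivation P P = -pderiv 1 P * P := by simpa using pencilDerivation_pencil P 0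
  have hDh : D (algebraMap (MvPolynomial (Fin 2) K) L P /
      algebraMap (MvPolynomial (Fin 2) K) L (X 0)) = 0 := by
    rw [Derivation.leibniz_div, hD, hD, hDP, pencilDerivation_X]
    simp only [map_mul, smul_eq_mul]
    ring
  obtain ⟨p, hp, hpa⟩ := isAlgebraic_adjoin_of_derivation_eq_zero htr D
    (fun h => hDX (by rw [h]; rfl)) (transcendental_div_X hP0) ha hDh
  choose N₀ hN₀ using fun i => exists_mem_pencilForms_of_mem_adjoin (p.coeff i).2
  set N := (Finset.range (p.natDegree + 1)).sup N₀
  have hex : ∀ i, i ∈ Finset.range (p.natDegree + 1) → ∃ g ∈ pencilForms P N,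
      algebraMap (MvPolynomial (Fin 2) K) L g =
        algebraMap (MvPolynomial (Fin 2) K) L (X 0) ^ N * (p.coeff i : L) :=
    fun i hi => hN₀ i N (Finset.le_sup hi)
  choose! g hgmem hg using hex
  set q : Polynomial (MvPolynomial (Fin 2) K) :=
    ∑ i ∈ Finset.range (p.natDegree + 1), Polynomial.monomial i (g i) with hq
  have hcoeff : q.coeff p.natDegree = g p.natDegree := by
    simp [hq, Polynomial.coeff_monomial]
  have hlast := Finset.self_mem_range_succ p.natDegree
  have hgne : g p.natDegree ≠ 0 := by
    intro h0
    have h := hg _ hlast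
    rw [h0, map_zero, eq_comm, mul_eq_zero] at h
    rcases h with h | h
    · exact pow_ne_zero _ hx h
    · exact hp (Polynomial.leadingCoeff_eq_zero.1 (Subtype.ext h))
  have hdeg : q.natDegree = p.natDegree :=
    Polynomial.natDegree_eq_of_le_of_coeff_ne_zero
      (Polynomial.natDegree_sum_le_of_forall_le _ _ fun i hi =>
        (Polynomial.natDegree_monomial_le _).trans
          (Nat.lt_succ_iff.1 (Finset.mem_range.1 hi))) (by rwa [hcoeff])
  have hroot : Polynomial.aeval a q = 0 := by
    rw [Polynomial.aeval_eq_sum_range] at hpa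
    rw [hq, map_sum, ← mul_zero (algebraMap (MvPolynomial (Fin 2) K) L (X 0) ^ N), ← hpa,
      Finset.mul_sum]
    refine Finset.sum_congr rfl fun i hi => ?_
    rw [Polynomial.aeval_monomial, hg i hi, mul_assoc]
    rfl
  have hint := isIntegral_leadingCoeff_smul q a hroot
  rw [Polynomial.leadingCoeff, hdeg, hcoeff] at hint
  obtain ⟨Z, hZ⟩ := IsIntegrallyClosed.isIntegral_iff.1 hint
  rw [Algebra.smul_def] at hZ
  refine ⟨N, _, hgmem _ hlast, Z, mem_pencilForms_of_pencilDerivation hP0 hP1 (hinj ?_), hgne,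
    hZ.symm⟩
  rw [← hD, hZ, Derivation.leibniz, ha, hD, pencilDerivation_of_mem_pencilForms (hgmem _ hlast),
    map_mul, map_mul, hZ]
  simp only [smul_eq_mul]
  ring

theorem pderiv_comm {σ R : Type*} [CommRing R] (i j : σ) (p : MvPolynomial σ R) :
    pderiv i (pderiv j p) = pderiv j (pderiv i p) := by
  classical
  suffices h : ⁅pderiv (R := R) i, pderiv j⁆ = 0 by
    rw [← sub_eq_zero, ← Derivation.commutator_apply, h]; rfl
  refine derivation_ext fun k => ?_
  rw [Derivation.commutator_apply, pderiv_X, pderiv_X]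
  simp only [Pi.single_apply]
  split_ifs <;> simp

/-- Numerator, over the common denominator `∏ G`, of the `i`-th coefficient of the logarithmic
form `∑ c dG / G`. -/
noncomputable def logNumerator {ι σ : Type*} [Fintype ι] [DecidableEq ι] (c : ι → K)
    (G : ι → MvPolynomial σ K) (i : σ) : MvPolynomial σ K :=
  ∑ s, C (c s) * (∏ s' ∈ Finset.univ.erase s, G s') * pderiv i (G s)

/-- If a linear combination with constant coefficients of the cofactors of some Darboux
polynomials vanishes, then the corresponding logarithmic form is a multiple of `d (P / X₀)` by a
quotient of forms in `P` and `X₀`. -/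
theorem exists_pencilForms_of_sum_cofactor_eq_zero [IsAlgClosed K] [CharZero K] (L : Type*)
    [Field L] [Algebra K L] [Algebra (MvPolynomial (Fin 2) K) L]
    [IsScalarTower K (MvPolynomial (Fin 2) K) L] [IsFractionRing (MvPolynomial (Fin 2) K) L]
    (htr : Algebra.trdeg K L ≤ 2) {ι : Type*} [Fintype ι] [DecidableEq ι]
    {P : MvPolynomial (Fin 2) K} (hP0 : coeff 0 P ≠ 0)
    (hP1 : pderiv 1 P ≠ 0) {G Λ : ι → MvPolynomial (Fin 2) K} (hG : ∀ s, G s ≠ 0)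
    (hΛ : ∀ s, pencilDerivation P (G s) = Λ s * G s) {c : ι → K} (hc : ∑ s, C (c s) * Λ s = 0) :
    ∃ N, ∃ Q ∈ pencilForms P N, ∃ Z ∈ pencilForms P N, Q ≠ 0 ∧ ∀ i,
      Q * X 0 ^ 2 * logNumerator c G i =
        Z * (∏ s, G s) * (X 0 * pderiv i P - P * pderiv i (X 0)) := by
  let φ := algebraMap (MvPolynomial (Fin 2) K) L
  have hφ : ∀ {r}, r ≠ 0 → φ r ≠ 0 := fun h => by
    rwa [Ne, FaithfulSMul.algebraMap_eq_zero_iff]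
  choose d hd using fun i : Fin 2 => exists_derivation_fractionRing (L := L) (pderiv (R := K) i)
  change ∀ i r, d i (φ r) = φ (pderiv i r) at hd
  have hcomm : ∀ z, d 0 (d 1 z) = d 1 (d 0 z) := by
    have hR : ∀ r, ⁅d 0, d 1⁆ (φ r) = 0 := fun r => by
      rw [Derivation.commutator_apply, hd, hd, hd, hd, pderiv_comm, sub_self]
    intro z
    obtain ⟨a, b, -, rfl⟩ := IsFractionRing.div_surjective (A := MvPolynomial (Fin 2) K) z
    rw [← sub_eq_zero, ← Derivation.commutator_apply, Derivation.leibniz_div]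
    change _ • (_ • ⁅d 0, d 1⁆ (φ a) - _ • ⁅d 0, d 1⁆ (φ b)) = 0
    rw [hR, hR]
    simp
  have hx : φ (X 0) ≠ 0 := hφ (X_ne_zero 0)
  set h := φ P / φ (X 0) with hh
  set ω : Fin 2 → MvPolynomial (Fin 2) K := fun i => X 0 * pderiv i P - P * pderiv i (X 0) with hω
  have hdh : ∀ i, d i h = φ (ω i) / φ (X 0) ^ 2 := fun i => by
    rw [hh, Derivation.leibniz_div, hd, hd]
    simp only [hω, map_sub, map_mul, smul_eq_mul]
    field_simp
  set η : Fin 2 → L := fun i => ∑ s, φ (C (c s)) * (d i (φ (G s)) / φ (G s)) with hη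
  have hηθ : ∀ i, φ (∏ s, G s) * η i = φ (logNumerator c G i) := fun i => by
    rw [hη, logNumerator, map_sum, Finset.mul_sum]
    refine Finset.sum_congr rfl fun s _ => ?_
    rw [← Finset.mul_prod_erase _ _ (Finset.mem_univ s), hd]
    simp only [map_mul]
    have := hφ (hG s)
    field_simp
  have hclosed : d 0 (η 1) = d 1 (η 0) := by
    simp only [hη, map_sum]
    refine Finset.sum_congr rfl fun s _ => ?_
    have hC : ∀ i, d i (φ (C (c s))) = 0 := fun i => by rw [hd, pderiv_C, map_zero]
    rw [Derivation.leibniz, Derivation.leibniz, hC, hC, Derivation.leibniz_div,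
      Derivation.leibniz_div, hcomm]
    simp only [smul_eq_mul]
    ring
  have hω1 : φ (ω 1) ≠ 0 := hφ (by simpa [hω, pderiv_X_of_ne] using hP1)
  have hrel : φ (ω 0) * η 1 = φ (ω 1) * η 0 := by
    refine mul_left_cancel₀ (b := φ (ω 0) * η 1)
      (hφ (Finset.prod_ne_zero_iff.2 fun (s : ι) (_ : s ∈ Finset.univ) => hG s)) ?_
    rw [mul_left_comm, hηθ, mul_left_comm, hηθ, ← map_mul, ← map_mul, ← sub_eq_zero, ← map_sub]
    convert map_zero φ
    rw [← mul_zero (∏ s, G s), ← hc, logNumerator, logNumerator, Finset.mul_sum, Finset.mul_sum,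
      Finset.mul_sum, ← Finset.sum_sub_distrib]
    refine Finset.sum_congr rfl fun s _ => ?_
    have := hΛ s
    rw [pencilDerivation_apply] at this
    rw [← Finset.mul_prod_erase _ _ (Finset.mem_univ s)]
    simp only [hω, pderiv_X_self, pderiv_X_of_ne (show (0 : Fin 2) ≠ 1 by decide)]
    linear_combination (C (c s) * ∏ s' ∈ Finset.univ.erase s, G s') * this
  set a := η 1 / d 1 h with ha
  have hh1 : d 1 h ≠ 0 := by rw [hdh]; exact div_ne_zero hω1 (pow_ne_zero _ hx)
  have ha' : ∀ i, η i = a * d i h := by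
    rw [Fin.forall_fin_two]
    refine ⟨?_, by rw [ha]; field_simp⟩
    rw [ha, hdh, hdh]
    field_simp
    linear_combination -hrel
  have hda : d 0 a * d 1 h = d 1 a * d 0 h := by
    rw [ha' 0, ha' 1, Derivation.leibniz, Derivation.leibniz, hcomm] at hclosed
    simp only [smul_eq_mul] at hclosed
    linear_combination hclosed
  obtain ⟨N, Q, hQ, Z, hZ, hQ0, hQZ⟩ := exists_pencilForms_mul_eq (L := L)
    htr hP0 hP1 (φ (ω 0) • d 1 - φ (ω 1) • d 0) (a := a)
    (fun r => by
      change _ = φ (pencilDerivation P r)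
      change φ (ω 0) • d 1 (φ r) - φ (ω 1) • d 0 (φ r) = _
      rw [hd, hd, pencilDerivation_apply, smul_eq_mul, smul_eq_mul, ← map_mul, ← map_mul,
        ← map_sub]
      simp [hω])
    (by
      change φ (ω 0) • d 1 a - φ (ω 1) • d 0 a = 0
      rw [hdh, hdh] at hda
      field_simp at hda
      simp only [smul_eq_mul]
      linear_combination -hda)
  refine ⟨N, Q, hQ, Z, hZ, hQ0, fun i => IsFractionRing.injective (MvPolynomial (Fin 2) K) L ?_⟩
  change φ Q * a = φ Z at hQZ
  change φ _ = φ (Z * (∏ s, G s) * ω i)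
  have h1 := ha' i
  rw [hdh] at h1
  field_simp at h1
  simp only [map_mul, ← hηθ, ← hQZ, map_pow]
  linear_combination (φ Q * φ (∏ s, G s)) * h1

theorem not_dvd_logNumerator {ι σ : Type*} [Fintype ι] [DecidableEq ι] {c : ι → K}
    {G : ι → MvPolynomial σ K} {s₀ : ι} (hs₀ : c s₀ ≠ 0) (hirr : Prime (G s₀))
    (hdvd : ∀ s, s ≠ s₀ → ¬ G s₀ ∣ G s) {i : σ} (hi : ¬ G s₀ ∣ pderiv i (G s₀)) :
    ¬ G s₀ ∣ logNumerator c G i := by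
  rw [logNumerator, ← Finset.add_sum_erase _ _ (Finset.mem_univ s₀), dvd_add_left]
  · rw [hirr.dvd_mul, hirr.dvd_mul, hirr.dvd_finsetProd_iff]
    rintro ((h | ⟨s, hs, h⟩) | h)
    · exact hirr.not_isUnit (isUnit_of_dvd_unit h ((isUnit_iff_ne_zero.2 hs₀).map C))
    · exact hdvd s (Finset.ne_of_mem_erase hs) h
    · exact hi h
  · refine Finset.dvd_sum fun s hs => Dvd.dvd.mul_right (Dvd.dvd.mul_left ?_ _) _
    exact Finset.dvd_prod_of_mem G
      (Finset.mem_erase.2 ⟨(Finset.ne_of_mem_erase hs).symm, Finset.mem_univ s₀⟩)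

/-- The order of vanishing along a component `H` of a member `f` of the pencil drops by exactly
one under differentiation. -/
theorem not_pow_dvd_wronskian [CharZero K] {σ : Type*} {H w x : MvPolynomial σ K}
    (hH : Prime H) (hw : ¬ H ∣ w) (hx : ¬ H ∣ x) {i : σ} (hi : ¬ H ∣ pderiv i H) {m : ℕ}
    (hm : m ≠ 0) :
    ¬ H ^ m ∣ x * pderiv i (H ^ m * w) - (H ^ m * w) * pderiv i x := by
  obtain ⟨m, rfl⟩ := Nat.exists_eq_succ_of_ne_zero hm
  have h : x * pderiv i (H ^ (m + 1) * w) - (H ^ (m + 1) * w) * pderiv i x =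
      H ^ (m + 1) * (x * pderiv i w - w * pderiv i x) +
        H ^ m * (C (m + 1 : K) * (x * (w * pderiv i H))) := by
    rw [pderiv_mul, pderiv_pow]
    simp only [Nat.cast_add, Nat.cast_one, Nat.add_sub_cancel, C_add, C_1, map_natCast]
    ring
  rw [Nat.succ_eq_add_one, h, dvd_add_right (dvd_mul_right _ _), pow_succ,
    mul_dvd_mul_iff_left (pow_ne_zero _ hH.ne_zero), hH.dvd_mul, hH.dvd_mul, hH.dvd_mul]
  rintro (h | h | h | h)
  · exact hH.not_isUnit (isUnit_of_dvd_unit h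
      ((isUnit_iff_ne_zero.2 (by exact_mod_cast m.succ_ne_zero)).map C))
  · exact hx h
  · exact hw h
  · exact hi h

theorem eq_zero_of_logNumerator_eq [CharZero K] {ι : Type*} [Fintype ι] [DecidableEq ι]
    {P : MvPolynomial (Fin 2) K} {c : ι → K} {G : ι → MvPolynomial (Fin 2) K} {s₀ : ι}
    (hs₀ : c s₀ ≠ 0) (hirr : Irreducible (G s₀)) (hdvd : ∀ s, s ≠ s₀ → ¬ G s₀ ∣ G s)
    (hX : ¬ G s₀ ∣ X 0) {t : K} (ht : G s₀ ∣ P + C t * X 0) (hf : P + C t * X 0 ≠ 0)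
    {H : MvPolynomial (Fin 2) K} (hH : Irreducible H) (hHt : H ∣ P + C t * X 0)
    (hHG : ∀ s, ¬ H ∣ G s) (hHX : ¬ H ∣ X 0) {N : ℕ} :
    ∀ Q ∈ pencilForms P N, ∀ Z ∈ pencilForms P N,
    (∀ i, Q * X 0 ^ 2 * logNumerator c G i =
        Z * (∏ s, G s) * (X 0 * pderiv i P - P * pderiv i (X 0))) → Q = 0 := by
  obtain ⟨i, hi⟩ := exists_not_dvd_pderiv hirr
  obtain ⟨j, hj⟩ := exists_not_dvd_pderiv hH
  obtain ⟨m, w, hw, hfw⟩ := WfDvdMonoid.max_power_factor hf hH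
  have hm : m ≠ 0 := by
    rintro rfl
    rw [pow_zero, one_mul] at hfw
    exact hw (hfw ▸ hHt)
  have hω : ∀ i, X 0 * pderiv i P - P * pderiv i (X 0) =
      X 0 * pderiv i (P + C t * X 0) - (P + C t * X 0) * pderiv i (X 0) := fun i => by
    rw [map_add, pderiv_C_mul]; ring
  have hGQ : ∀ {Q Z}, (∀ i, Q * X 0 ^ 2 * logNumerator c G i =
      Z * (∏ s, G s) * (X 0 * pderiv i P - P * pderiv i (X 0))) → G s₀ ∣ Q := by
    intro Q Z h
    have h1 : G s₀ ∣ Q * X 0 ^ 2 * logNumerator c G i := by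
      rw [h i]
      exact Dvd.dvd.mul_right (Dvd.dvd.mul_left (Finset.dvd_prod_of_mem G (Finset.mem_univ _)) _) _
    rcases hirr.prime.dvd_or_dvd h1 with h1 | h1
    · exact (hirr.prime.dvd_or_dvd h1).resolve_right
        fun h2 => hX (hirr.prime.dvd_of_dvd_pow h2)
    · exact absurd h1 (not_dvd_logNumerator hs₀ hirr.prime hdvd hi)
  induction N with
  | zero =>
    intro Q hQ Z _ h
    obtain ⟨a, rfl⟩ := eq_C_of_mem_pencilForms_zero hQ
    by_contra ha
    exact hirr.not_isUnit (isUnit_of_dvd_unit (hGQ h)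
      ((isUnit_iff_ne_zero.2 fun h0 => ha (by rw [h0, C_0])).map C))
  | succ N ih =>
    intro Q hQ Z hZ h
    obtain ⟨Q', hQ', a, rfl⟩ := exists_eq_mul_add_of_mem_pencilForms hQ t
    obtain ⟨Z', hZ', b, rfl⟩ := exists_eq_mul_add_of_mem_pencilForms hZ t
    have hCX : ∀ {F : MvPolynomial (Fin 2) K} {e : K}, Prime F → ¬ F ∣ X 0 →
        F ∣ C e * X 0 ^ (N + 1) → e = 0 := by
      intro F e hF hFX h
      rcases hF.dvd_or_dvd h with h | h
      · by_contra he
        exact hF.not_isUnit (isUnit_of_dvd_unit h ((isUnit_iff_ne_zero.2 he).map C))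
      · exact absurd (hF.dvd_of_dvd_pow h) hFX
    obtain rfl : a = 0 := hCX hirr.prime hX
      ((dvd_add_right (Dvd.dvd.mul_right ht Q')).1 (hGQ h))
    obtain rfl : b = 0 := by
      by_contra hb
      refine not_pow_dvd_wronskian hH.prime hw hHX hj hm ?_
      rw [← hfw, ← hω]
      have h1 : H ^ m ∣ ((P + C t * X 0) * Q' + C 0 * X 0 ^ (N + 1)) * X 0 ^ 2 *
          logNumerator c G j := by
        rw [C_0, zero_mul, add_zero, hfw, mul_assoc, mul_assoc, mul_assoc]
        exact dvd_mul_right _ _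
      rw [h j] at h1
      refine hH.prime.pow_dvd_of_dvd_mul_left _ (fun h2 => ?_) h1
      rcases hH.prime.dvd_or_dvd h2 with h2 | h2
      · exact hb (hCX hH.prime hHX ((dvd_add_right (Dvd.dvd.mul_right hHt Z')).1 h2))
      · obtain ⟨s, -, hs⟩ := (hH.prime.dvd_finsetProd_iff _).1 h2
        exact hHG s hs
    rw [C_0, zero_mul, add_zero, ih Q' hQ' Z' hZ' fun i => mul_left_cancel₀ hf ?_, mul_zero]
    have := h i
    rw [C_0, zero_mul, add_zero, add_zero] at this
    linear_combination this

theorem not_dvd_X_of_dvd_pencil {P F : MvPolynomial (Fin 2) K} (hP0 : coeff 0 P ≠ 0)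
    (hF : Irreducible F) {t : K} (h : F ∣ P + C t * X 0) : ¬ F ∣ X 0 := by
  intro hX
  have hX' : X 0 ∣ P + C t * X 0 :=
    ((hF.dvd_irreducible_iff_associated X_prime.irreducible).1 hX).dvd'.trans h
  rw [dvd_add_left (dvd_mul_left _ _)] at hX'
  obtain ⟨q, rfl⟩ := hX'
  exact hP0 (by simp [← constantCoeff_eq])

theorem eq_of_dvd_pencil {P F : MvPolynomial (Fin 2) K} (hP0 : coeff 0 P ≠ 0)
    (hF : Irreducible F) {s t : K} (hs : F ∣ P + C s * X 0) (ht : F ∣ P + C t * X 0) : s = t := by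
  have h : F ∣ C (s - t) * X 0 := by
    rw [C_sub]
    convert dvd_sub hs ht using 1
    ring
  by_contra hne
  rcases hF.prime.dvd_or_dvd h with h | h
  · exact hF.not_isUnit (isUnit_of_dvd_unit h ((isUnit_iff_ne_zero.2 (sub_ne_zero.2 hne)).map C))
  · exact not_dvd_X_of_dvd_pencil hP0 hF hs h

theorem linearIndependent_cofactor [IsAlgClosed K] [CharZero K] {ι : Type*} [Fintype ι]
    [DecidableEq ι] {P : MvPolynomial (Fin 2) K} (hP0 : coeff 0 P ≠ 0) (hP1 : pderiv 1 P ≠ 0)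
    {τ : ι → K} (hτ : Function.Injective τ) {F H Λ : ι → MvPolynomial (Fin 2) K}
    (hF : ∀ s, Irreducible (F s)) (hFτ : ∀ s, F s ∣ P + C (τ s) * X 0)
    (hH : ∀ s, Irreducible (H s)) (hHτ : ∀ s, H s ∣ P + C (τ s) * X 0)
    (hHF : ∀ s, ¬ H s ∣ F s) (hΛ : ∀ s, pencilDerivation P (F s) = Λ s * F s) :
    LinearIndependent K (fun o : Option ι => o.elim (-pderiv 1 P) Λ) := by
  rw [Fintype.linearIndependent_iff]
  intro c hc
  set G : Option ι → MvPolynomial (Fin 2) K := fun o => o.elim (X 0) F with hG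
  have hsome : ∀ s, c (some s) = 0 := by
    by_contra! hcon
    obtain ⟨s₀, hs₀⟩ := hcon
    have hf : P + C (τ s₀) * X 0 ≠ 0 := fun h => hP1 (by
      simpa [pderiv_X_of_ne] using congrArg (pderiv 1) h)
    obtain ⟨N, Q, hQ, Z, hZ, hQ0, h⟩ := exists_pencilForms_of_sum_cofactor_eq_zero
      (FractionRing (MvPolynomial (Fin 2) K)) trdeg_fractionRing_fin_two hP0 hP1
      (G := G) (Λ := fun o => o.elim (-pderiv 1 P) Λ) (c := c)
      (by rintro (_ | s); exacts [X_ne_zero 0, (hF s).ne_zero])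
      (by rintro (_ | s); exacts [pencilDerivation_X P, hΛ s])
      (by simpa only [smul_eq_C_mul] using hc)
    refine hQ0 (eq_zero_of_logNumerator_eq (G := G) (s₀ := some s₀) hs₀ (hF s₀) ?_
      (not_dvd_X_of_dvd_pencil hP0 (hF s₀) (hFτ s₀)) (hFτ s₀) hf (hH s₀) (hHτ s₀) ?_
      (not_dvd_X_of_dvd_pencil hP0 (hH s₀) (hHτ s₀)) Q hQ Z hZ h)
    · rintro (_ | s) hs hdvd
      · exact not_dvd_X_of_dvd_pencil hP0 (hF s₀) (hFτ s₀) hdvd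
      · exact hs (congrArg some
          (hτ (eq_of_dvd_pencil hP0 (hF s₀) (hdvd.trans (hFτ s)) (hFτ s₀))))
    · rintro (_ | s) hdvd
      · exact not_dvd_X_of_dvd_pencil hP0 (hH s₀) (hHτ s₀) hdvd
      · obtain rfl := hτ (eq_of_dvd_pencil hP0 (hH s₀) (hdvd.trans (hFτ s)) (hHτ s₀))
        exact hHF s hdvd
  rintro (_ | s)
  · simpa [Fintype.sum_option, hsome, hP1] using hc
  · exact hsome s

/-- Fewer than `d ^ 2` plane polynomials of degree less than `d ≥ 2` can be linearly
independent. -/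
theorem card_le_of_linearIndependent_of_totalDegree_lt {ι : Type*} [Fintype ι] {d : ℕ}
    (hd : 2 ≤ d) {v : ι → MvPolynomial (Fin 2) K} (hv : LinearIndependent K v)
    (hdeg : ∀ s, (v s).totalDegree < d) : Fintype.card ι ≤ d ^ 2 - 1 := by
  classical
  let e : ℕ × ℕ → MvPolynomial (Fin 2) K := fun a =>
    monomial (Finsupp.single 0 a.1 + Finsupp.single 1 a.2) 1
  let w := ((Finset.range d ×ˢ Finset.range d).erase (d - 1, d - 1)).image e
  have hw : w.card ≤ d ^ 2 - 1 := by
    refine Finset.card_image_le.trans ?_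
    rw [Finset.card_erase_of_mem (by simp; omega), Finset.card_product, Finset.card_range, sq]
  suffices h : Set.range v ≤ Submodule.span K (w : Set (MvPolynomial (Fin 2) K)) by
    simpa using (linearIndependent_le_span_aux' v hv w h).trans (by simpa using hw)
  rintro _ ⟨s, rfl⟩
  rw [SetLike.mem_coe, (v s).as_sum]
  refine Submodule.sum_mem _ fun m hm => ?_
  have hm' : m 0 + m 1 < d := by
    have := (le_totalDegree hm).trans_lt (hdeg s)
    rwa [Finsupp.sum_fintype _ _ (fun _ => rfl), Fin.sum_univ_two] at this
  have : monomial m (coeff m (v s)) = coeff m (v s) • e (m 0, m 1) := by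
    rw [smul_monomial, smul_eq_mul, mul_one]
    congr 2
    ext k
    fin_cases k <;> simp
  rw [this]
  refine Submodule.smul_mem _ _ (Submodule.subset_span ?_)
  refine Finset.mem_coe.2 (Finset.mem_image_of_mem e (Finset.mem_erase.2 ⟨?_, ?_⟩))
  · rw [Ne, Prod.mk.injEq]; omega
  · rw [Finset.mem_product, Finset.mem_range, Finset.mem_range]; constructor <;> dsimp only <;> omega

theorem totalDegree_lt_of_dvd_pderiv_pow {σ : Type*} {F G : MvPolynomial σ K} {i : σ}
    (hF : Prime F) (hFG : ¬ F ∣ G) {l : ℕ} {u : K} (hne : pderiv i (G ^ l * C u) ≠ 0)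
    (h : F ∣ pderiv i (G ^ l * C u)) : F.totalDegree < G.totalDegree := by
  have heq : pderiv i (G ^ l * C u) = C (l * u) * G ^ (l - 1) * pderiv i G := by
    rw [mul_comm, pderiv_C_mul, pderiv_pow, C_mul, map_natCast]; ring
  rw [heq] at h hne
  have hG := right_ne_zero_of_mul hne
  rcases hF.dvd_or_dvd h with h | h
  · rcases hF.dvd_or_dvd h with h | h
    · exact absurd (isUnit_of_dvd_unit h ((isUnit_iff_ne_zero.2 fun h0 => hne (by
        rw [h0, C_0, zero_mul, zero_mul])).map C)) hF.not_isUnit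
    · exact absurd (hF.dvd_of_dvd_pow h) hFG
  · exact (totalDegree_le_of_dvd_of_isDomain h hG).trans_lt (totalDegree_pderiv_lt hG)

theorem dvd_pderiv_pow_mul {σ : Type*} (F w : MvPolynomial σ K) (i : σ) {k : ℕ} (hk : 2 ≤ k) :
    F ∣ pderiv i (F ^ k * w) := by
  rw [pderiv_mul, pderiv_pow]
  exact dvd_add (((dvd_pow_self F (by omega)).mul_left _).mul_right _ |>.mul_right _)
    ((dvd_pow_self F (by omega)).mul_right _)

theorem dvd_derivation_of_pow_mul [CharZero K] {σ : Type*}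
    (D : Derivation K (MvPolynomial σ K) (MvPolynomial σ K)) {F w : MvPolynomial σ K}
    (hF : Prime F) (hw : ¬ F ∣ w) {m : ℕ} (hm : m ≠ 0) (h : F ^ m ∣ D (F ^ m * w)) :
    F ∣ D F := by
  obtain ⟨m, rfl⟩ := Nat.exists_eq_succ_of_ne_zero hm
  have heq : D (F ^ (m + 1) * w) =
      F ^ (m + 1) * D w + F ^ m * (C (m + 1 : K) * (w * D F)) := by
    rw [Derivation.leibniz, Derivation.leibniz_pow]
    simp only [Nat.add_sub_cancel, C_add, C_1, map_natCast, smul_eq_mul, nsmul_eq_mul,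
      Nat.cast_add, Nat.cast_one]
    ring
  rw [Nat.succ_eq_add_one, heq, dvd_add_right (dvd_mul_right _ _), pow_succ,
    mul_dvd_mul_iff_left (pow_ne_zero _ hF.ne_zero), hF.dvd_mul, hF.dvd_mul] at h
  rcases h with h | h | h
  · exact absurd (isUnit_of_dvd_unit h
      ((isUnit_iff_ne_zero.2 (by exact_mod_cast m.succ_ne_zero)).map C)) hF.not_isUnit
  · exact absurd h hw
  · exact h

theorem totalDegree_pderiv_le {σ R : Type*} [CommSemiring R] (i : σ) (p : MvPolynomial σ R) :
    (pderiv i p).totalDegree ≤ p.totalDegree - 1 := by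
  by_cases h : pderiv i p = 0
  · simp [h]
  · exact Nat.le_sub_one_of_lt (totalDegree_pderiv_lt h)

theorem totalDegree_cofactor_lt {P F Λ : MvPolynomial (Fin 2) K} (hP : P.totalDegree ≠ 0)
    (hF : F ≠ 0) (hΛ : pencilDerivation P F = Λ * F) : Λ.totalDegree < P.totalDegree := by
  by_cases hΛ0 : Λ = 0
  · rw [hΛ0, totalDegree_zero]; omega
  have hX : ∀ i, (X 0 * pderiv i P).totalDegree ≤ P.totalDegree := fun i => by
    refine (totalDegree_mul _ _).trans ?_
    have := totalDegree_pderiv_le i P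
    rw [totalDegree_X]
    omega
  have h0 := totalDegree_sub (X 0 * pderiv 0 P) P
  have h1 := totalDegree_mul (X 0 * pderiv 0 P - P) (pderiv 1 F)
  have h2 := totalDegree_mul (X 0 * pderiv 1 P) (pderiv 0 F)
  have h3 := totalDegree_sub ((X 0 * pderiv 0 P - P) * pderiv 1 F)
    ((X 0 * pderiv 1 P) * pderiv 0 F)
  have h4 := totalDegree_pderiv_le 0 F
  have h5 := totalDegree_pderiv_le 1 F
  have hdeg := congrArg totalDegree hΛ
  rw [totalDegree_mul_of_isDomain hΛ0 hF, pencilDerivation_apply] at hdeg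
  have hF1 : F.totalDegree ≠ 0 := by
    intro hF1
    obtain ⟨c, rfl⟩ : ∃ c, F = C c := ⟨_, totalDegree_eq_zero_iff_eq_C.1 hF1⟩
    rw [pencilDerivation_apply, pderiv_C, pderiv_C, mul_zero, mul_zero, sub_zero] at hΛ
    exact mul_ne_zero hΛ0 hF hΛ.symm
  have := hX 0
  have := hX 1
  omega

theorem eq_of_pencil_eq_pow_mul_isUnit {P : MvPolynomial (Fin 2) K} (hP0 : coeff 0 P ≠ 0)
    (hP1 : pderiv 1 P ≠ 0) {s t : K} {F G u v : MvPolynomial (Fin 2) K} (hF : Irreducible F)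
    (hG : Irreducible G) (hu : IsUnit u) (hv : IsUnit v) {k l : ℕ} (hk : 2 ≤ k) (hl : 2 ≤ l)
    (hs : P + C s * X 0 = F ^ k * u) (ht : P + C t * X 0 = G ^ l * v) : s = t := by
  by_contra hst
  have hFs : F ∣ P + C s * X 0 := by rw [hs]; exact (dvd_pow_self F (by omega)).mul_right _
  have hGt : G ∣ P + C t * X 0 := by rw [ht]; exact (dvd_pow_self G (by omega)).mul_right _
  have hd : ∀ a, pderiv 1 (P + C a * X 0) = pderiv 1 P := fun a => by
    rw [map_add, pderiv_C_mul, pderiv_X_of_ne (by decide), mul_zero, add_zero]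
  obtain ⟨u, -, rfl⟩ := isUnit_iff_eq_C_of_isReduced.1 hu
  obtain ⟨v, -, rfl⟩ := isUnit_iff_eq_C_of_isReduced.1 hv
  have hFd := dvd_pderiv_pow_mul F (C u) 1 hk
  have hGd := dvd_pderiv_pow_mul G (C v) 1 hl
  have hFne : pderiv 1 (F ^ k * C u) ≠ 0 := by rwa [← hs, hd]
  have hGne : pderiv 1 (G ^ l * C v) ≠ 0 := by rwa [← ht, hd]
  rw [← hs, hd, ← hd t, ht] at hFd
  rw [← ht, hd, ← hd s, hs] at hGd
  exact lt_asymm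
    (totalDegree_lt_of_dvd_pderiv_pow hF.prime
      (fun h => hst (eq_of_dvd_pencil hP0 hF hFs (h.trans hGt))) hGne hFd)
    (totalDegree_lt_of_dvd_pderiv_pow hG.prime
      (fun h => hst (eq_of_dvd_pencil hP0 hG (h.trans hFs) hGt)) hFne hGd)

theorem card_le_of_forall_not_irreducible_pencil [IsAlgClosed K] [CharZero K]
    {P : MvPolynomial (Fin 2) K} (hP0 : coeff 0 P ≠ 0) (hP1 : pderiv 1 P ≠ 0) {T : Finset K}
    (hT : ∀ t ∈ T, ¬ Irreducible (P + C t * X 0)) : T.card ≤ P.totalDegree ^ 2 - 1 := by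
  classical
  have hf : ∀ t, P + C t * X 0 ≠ 0 := fun t h => hP1 (by
    simpa [pderiv_X_of_ne] using congrArg (pderiv 1) h)
  have hfu : ∀ t, ¬ IsUnit (P + C t * X 0) := fun t h => hP1 (by
    obtain ⟨c, -, hc⟩ := isUnit_iff_eq_C_of_isReduced.1 h
    simpa [pderiv_X_of_ne] using congrArg (pderiv 1) hc)
  have hd0 : P.totalDegree ≠ 0 := fun h => hP1 (by
    rw [totalDegree_eq_zero_iff_eq_C.1 h, pderiv_C])
  have hfdeg : ∀ t, (P + C t * X 0).totalDegree ≤ P.totalDegree := fun t => by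
    refine (totalDegree_add _ _).trans (max_le le_rfl ?_)
    have := totalDegree_mul (C t) (X 0 : MvPolynomial (Fin 2) K)
    rw [totalDegree_C, totalDegree_X] at this
    omega
  rcases Nat.lt_or_ge P.totalDegree 2 with hd | hd
  · suffices T = ∅ by simp [this]
    refine Finset.eq_empty_of_forall_notMem fun t ht => hT t ht ⟨hfu t, fun {a b} hab => ?_⟩
    have ha := left_ne_zero_of_mul (hab ▸ hf t)
    have hb := right_ne_zero_of_mul (hab ▸ hf t)
    rw [isUnit_iff_totalDegree_eq_zero ha, isUnit_iff_totalDegree_eq_zero hb]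
    have := hfdeg t
    rw [hab, totalDegree_mul_of_isDomain ha hb] at this
    omega
  choose F hF hFt using fun t => WfDvdMonoid.exists_irreducible_factor (hfu t) (hf t)
  choose m w hw hfw using fun t => WfDvdMonoid.max_power_factor (hf t) (hF t)
  have hm : ∀ t, m t ≠ 0 := fun t h => hw t (by
    have := hFt t
    rwa [hfw t, h, pow_zero, one_mul] at this)
  have hpure : (T.filter fun t => IsUnit (w t)).card ≤ 1 := by
    refine Finset.card_le_one.2 fun s hs t ht => ?_
    obtain ⟨hs, hws⟩ := Finset.mem_filter.1 hs
    obtain ⟨ht, hwt⟩ := Finset.mem_filter.1 ht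
    have hm2 : ∀ t ∈ T, IsUnit (w t) → 2 ≤ m t := fun t ht hwt => by
      by_contra hlt
      have h1 : m t = 1 := by have := hm t; omega
      refine hT t ht ?_
      rw [hfw t, h1, pow_one, irreducible_mul_isUnit hwt]
      exact hF t
    exact eq_of_pencil_eq_pow_mul_isUnit hP0 hP1 (hF s) (hF t) hws hwt (hm2 s hs hws)
      (hm2 t ht hwt) (hfw s) (hfw t)
  set T' := T.filter fun t => ¬ IsUnit (w t) with hT'
  have hw0 : ∀ t, w t ≠ 0 := fun t h => hf t (by rw [hfw t, h, mul_zero])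
  choose H hH hHw using fun t : T' => WfDvdMonoid.exists_irreducible_factor
    (Finset.mem_filter.1 t.2).2 (hw0 t)
  have hΛ : ∀ t : T', ∃ Λ, pencilDerivation P (F t) = Λ * F t := fun t => by
    refine (dvd_derivation_of_pow_mul (pencilDerivation P) (hF t).prime (hw t) (hm t) ?_).imp
      fun Λ h => by rw [h, mul_comm]
    rw [← hfw t, pencilDerivation_pencil]
    exact Dvd.dvd.mul_left (by rw [hfw t]; exact dvd_mul_right _ _) _
  choose Λ hΛ using hΛ
  have hli := linearIndependent_cofactor hP0 hP1 Subtype.val_injective (fun t : T' => hF t)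
    (fun t => hFt t) hH (fun t => (hHw t).trans (by rw [hfw t]; exact dvd_mul_left _ _))
    (fun t h => hw t (((hH t).dvd_irreducible_iff_associated (hF t)).1 h |>.dvd'.trans (hHw t))) hΛ
  have hcard := card_le_of_linearIndependent_of_totalDegree_lt hd hli (by
    rintro (_ | t)
    · change (-pderiv 1 P).totalDegree < _
      rw [totalDegree_neg]
      exact totalDegree_pderiv_lt hP1
    · exact totalDegree_cofactor_lt hd0 (hF t).ne_zero (hΛ t))
  rw [Fintype.card_option, Fintype.card_coe] at hcard
  have : (T.filter fun t => IsUnit (w t)).card + T'.card = T.card := by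
    convert Finset.card_filter_add_card_filter_not (s := T) (fun t => IsUnit (w t))
  omega

end MvPolynomial

namespace MvPolynomial

theorem totalDegree_aeval_le {σ τ R : Type*} [CommSemiring R] {g : σ → MvPolynomial τ R}
    (hg : ∀ i, (g i).totalDegree ≤ 1) (p : MvPolynomial σ R) :
    (aeval g p).totalDegree ≤ p.totalDegree := by
  rw [aeval_def, eval₂_eq, algebraMap_eq]
  refine totalDegree_finsetSum_le fun m hm => (totalDegree_mul _ _).trans ?_
  rw [totalDegree_C, zero_add]
  refine (totalDegree_finsetProd _ _).trans (le_trans (Finset.sum_le_sum fun i _ => ?_)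
    (le_totalDegree hm))
  refine (totalDegree_pow _ _).trans ?_
  simpa using Nat.mul_le_mul_left (m i) (hg i)

theorem pderiv_aeval {σ τ R : Type*} [Fintype σ] [CommSemiring R] (g : σ → MvPolynomial τ R)
    (j : τ) (p : MvPolynomial σ R) :
    pderiv j (aeval g p) = ∑ i, aeval g (pderiv i p) * pderiv j (g i) := by
  classical
  induction p using MvPolynomial.induction_on with
  | C a => simp
  | add p q hp hq => simp only [map_add, hp, hq, add_mul, Finset.sum_add_distrib]
  | mul_X p k hp =>
    simp only [map_mul, aeval_X, pderiv_mul, hp, map_add, add_mul, Finset.sum_add_distrib,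
      Finset.sum_mul]
    congr 1
    · exact Finset.sum_congr rfl fun i _ => by ring
    · rw [Finset.sum_eq_single k]
      · simp
      · intro i _ hi
        simp [pderiv_X_of_ne hi.symm]
      · simp

theorem exists_forall_eval_ne_zero {ι σ R : Type*} [Fintype ι] [CommRing R] [IsDomain R]
    [Infinite R] [Finite σ] {q : ι → MvPolynomial σ R} (hq : ∀ i, q i ≠ 0) :
    ∃ c : σ → R, ∀ i, eval c (q i) ≠ 0 := by
  have h : ∏ i, q i ≠ 0 := Finset.prod_ne_zero_iff.2 fun i _ => hq i
  by_contra! hcon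
  refine h (MvPolynomial.funext fun c => ?_)
  obtain ⟨i, h0⟩ := hcon c
  rw [map_prod, map_zero, Finset.prod_eq_zero (Finset.mem_univ i) h0]

theorem X_dvd_sub_aeval {σ R : Type*} [DecidableEq σ] [CommRing R] (i₀ : σ)
    (p : MvPolynomial σ R) :
    X i₀ ∣ p - aeval (fun i => if i = i₀ then (0 : MvPolynomial σ R) else X i) p := by
  induction p using MvPolynomial.induction_on with
  | C a => simp
  | add p q hp hq =>
    rw [map_add, add_sub_add_comm]
    exact dvd_add hp hq
  | mul_X p k hp =>
    rw [map_mul, aeval_X]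
    split_ifs with h
    · subst h; simp
    · rw [← sub_mul]
      exact hp.mul_right _

/-- A generic plane section parallel to the `i₀`-axis preserves non-constancy of finitely many
polynomials. -/
theorem exists_plane_section {σ K : Type*} [Fintype σ] [DecidableEq σ] [Field K] [Infinite K]
    {i₀ i₁ : σ} (hi : i₁ ≠ i₀) {P : MvPolynomial σ K} (hP : pderiv i₁ P ≠ 0)
    (hX : ¬ X i₀ ∣ P) (S : Finset (MvPolynomial σ K)) (hS : ∀ p ∈ S, ∃ i, pderiv i p ≠ 0) :
    ∃ ψ : MvPolynomial σ K →ₐ[K] MvPolynomial (Fin 2) K, ψ (X i₀) = X 0 ∧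
      (∀ p, (ψ p).totalDegree ≤ p.totalDegree) ∧ coeff 0 (ψ P) ≠ 0 ∧ pderiv 1 (ψ P) ≠ 0 ∧
      ∀ p ∈ S, ¬ IsUnit (ψ p) := by
  choose k hk using fun p : S => hS p p.2
  set P₀ := aeval (fun i => if i = i₀ then (0 : MvPolynomial σ K) else X i) P with hP₀
  have hP₀ne : P₀ ≠ 0 := fun h => hX (by
    have := X_dvd_sub_aeval i₀ P
    rwa [← hP₀, h, sub_zero] at this)
  obtain ⟨c, hc⟩ := exists_forall_eval_ne_zero (ι := Option (Option S))
    (q := fun o => o.elim P₀ fun o => o.elim (pderiv i₁ P) fun p => pderiv (k p) p.1)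
    (by rintro (_ | _ | p); exacts [hP₀ne, hP, hk p])
  have hlin : ∀ (T : Finset σ) (v : σ → K) (i : σ), i ∈ T → v i ≠ 0 →
      ∑ i ∈ T, C (v i) * X i ≠ (0 : MvPolynomial σ K) := by
    intro T v i hiT hv h
    have := congrArg (eval (Pi.single i 1)) h
    simp [Pi.single_apply, hiT] at this
    exact hv this
  obtain ⟨a, ha⟩ := exists_forall_eval_ne_zero (ι := Option S)
    (q := fun o => o.elim (∑ i ∈ Finset.univ.erase i₀, C (eval c (pderiv i P)) * X i)
      fun p => ∑ i, C (eval c (pderiv i p.1)) * X i)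
    (by
      rintro (_ | p)
      · exact hlin _ _ i₁ (Finset.mem_erase.2 ⟨hi, Finset.mem_univ _⟩) (hc (some none))
      · exact hlin _ _ (k p) (Finset.mem_univ _) (hc (some (some p))))
  set g : σ → MvPolynomial (Fin 2) K := fun i =>
    if i = i₀ then X 0 else C (c i) + C (a i) * X 1 with hg
  set e : Fin 2 → K := Fin.cons (c i₀) 0
  have heval : ∀ p, eval e (aeval g p) = eval c p := by
    suffices (eval e).comp (aeval g).toRingHom = eval c from fun p => RingHom.congr_fun this p
    refine ringHom_ext (fun r => by simp) fun i => ?_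
    by_cases hi : i = i₀ <;> simp [hg, hi, e]
  have hd1 : ∀ p, eval e (pderiv 1 (aeval g p)) =
      ∑ i ∈ Finset.univ.erase i₀, eval c (pderiv i p) * a i := fun p => by
    rw [pderiv_aeval, map_sum, ← Finset.add_sum_erase _ _ (Finset.mem_univ i₀)]
    have : pderiv 1 (g i₀) = 0 := by simp [hg]
    rw [this, mul_zero, map_zero, zero_add]
    refine Finset.sum_congr rfl fun i hi => ?_
    rw [map_mul, heval]
    simp [hg, Finset.ne_of_mem_erase hi]
  have hd0 : ∀ p, eval e (pderiv 0 (aeval g p)) = eval c (pderiv i₀ p) := fun p => by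
    rw [pderiv_aeval, map_sum, Finset.sum_eq_single_of_mem i₀ (Finset.mem_univ i₀)]
    · rw [map_mul, heval]
      simp [hg]
    · intro i _ hi
      simp [hg, hi]
  refine ⟨aeval g, by simp [hg], totalDegree_aeval_le fun i => ?_, ?_, fun h => ?_, ?_⟩
  · simp only [hg]
    split_ifs
    · simp
    · refine (totalDegree_add _ _).trans (max_le (by simp) ((totalDegree_mul _ _).trans ?_))
      simp
  · have : (constantCoeff (σ := Fin 2)).comp (aeval g).toRingHom =
        (eval c).comp
          (aeval (R := K) fun i => if i = i₀ then (0 : MvPolynomial σ K) else X i).toRingHom := by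
      refine ringHom_ext (fun r => by simp) fun i => ?_
      by_cases hi : i = i₀ <;> simp [hg, hi]
    rw [← constantCoeff_eq]
    exact (RingHom.congr_fun this P).trans_ne (hc none)
  · refine ha none ?_
    have := hd1 P
    rw [h, map_zero] at this
    simpa using this.symm
  · intro p hp hu
    obtain ⟨r, -, hr⟩ := isUnit_iff_eq_C_of_isReduced.1 hu
    refine ha (some ⟨p, hp⟩) ?_
    have h0 := hd0 p
    have h1 := hd1 p
    rw [hr, pderiv_C, map_zero] at h0 h1
    simp only [Option.elim_some, map_sum, map_mul, eval_C, eval_X]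
    rw [← Finset.add_sum_erase _ _ (Finset.mem_univ i₀), ← h0, ← h1, zero_mul, zero_add]

theorem card_le_of_forall_not_irreducible {σ K : Type*} [Fintype σ] [DecidableEq σ] [Field K]
    [IsAlgClosed K] [CharZero K] {i₀ i₁ : σ} (hi : i₁ ≠ i₀) {P : MvPolynomial σ K}
    (hP : pderiv i₁ P ≠ 0) (hX : ¬ X i₀ ∣ P) {T : Finset K}
    (hT : ∀ t ∈ T, ¬ Irreducible (P + C t * X i₀)) : T.card ≤ P.totalDegree ^ 2 - 1 := by
  have hd : ∀ t, pderiv i₁ (P + C t * X i₀) ≠ 0 := fun t => by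
    rwa [map_add, pderiv_C_mul, pderiv_X_of_ne hi.symm, mul_zero, add_zero]
  have hfac : ∀ t : T, ∃ A B, P + C t.1 * X i₀ = A * B ∧ ¬ IsUnit A ∧ ¬ IsUnit B := fun t => by
    have := hT t t.2
    rw [irreducible_iff] at this
    by_contra! hcon
    refine this ⟨fun hu => ?_, fun {A B} hAB => or_iff_not_imp_left.2 (hcon A B hAB)⟩
    obtain ⟨r, -, hr⟩ := isUnit_iff_eq_C_of_isReduced.1 hu
    exact hd t (by rw [hr, pderiv_C])
  choose A B hAB hA hB using hfac
  have hne : ∀ t : T, A t * B t ≠ 0 := fun t h => hd t (by rw [hAB, h, map_zero])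
  have hex : ∀ {p : MvPolynomial σ K}, p ≠ 0 → ¬ IsUnit p → ∃ i, pderiv i p ≠ 0 := fun hp hu =>
    exists_pderiv_ne_zero fun h => hu ((isUnit_iff_totalDegree_eq_zero hp).2 h)
  classical
  obtain ⟨ψ, hψX, hψdeg, hψ0, hψ1, hψS⟩ := exists_plane_section hi hP hX
    (Finset.univ.image A ∪ Finset.univ.image B) (by
      intro p hp
      rcases Finset.mem_union.1 hp with hp | hp
      · obtain ⟨t, -, rfl⟩ := Finset.mem_image.1 hp
        exact hex (left_ne_zero_of_mul (hne t)) (hA t)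
      · obtain ⟨t, -, rfl⟩ := Finset.mem_image.1 hp
        exact hex (right_ne_zero_of_mul (hne t)) (hB t))
  refine (card_le_of_forall_not_irreducible_pencil hψ0 hψ1 fun t ht hirr => ?_).trans
    (Nat.sub_le_sub_right (Nat.pow_le_pow_left (hψdeg P) 2) 1)
  have h : ψ P + C t * X 0 = ψ (A ⟨t, ht⟩) * ψ (B ⟨t, ht⟩) := by
    rw [← map_mul, ← hAB, map_add, map_mul, hψX, show ψ (C t) = C t from ψ.commutes t]
  rcases hirr.isUnit_or_isUnit h with hu | hu
  · exact hψS _ (Finset.mem_union_left _ (Finset.mem_image_of_mem A (Finset.mem_univ _))) hu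
  · exact hψS _ (Finset.mem_union_right _ (Finset.mem_image_of_mem B (Finset.mem_univ _))) hu

end MvPolynomial

/-- If `P ∉ K[x₁]` and `x₁ ∤ P`, then `P + λ* x₁` is irreducible
in `K[x₁,…,xₙ]` for all but at most `deg(P)² − 1` values `λ* ∈ K`. -/
theorem irreducible_plus_lambda_x1
    {K : Type*} [Field K] [IsAlgClosed K] [CharZero K] {n : ℕ} (hn : 2 ≤ n)
    (P : MvPolynomial (Fin n) K)
    (hnot : ¬ ∀ m ∈ P.support, ∀ i : Fin n, i ≠ ⟨0, by omega⟩ → m i = 0)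
    (hndvd : ¬ X (⟨0, by omega⟩ : Fin n) ∣ P) :
    ∃ s : Finset K, s.card ≤ P.totalDegree ^ 2 - 1 ∧
      ∀ t : K, t ∉ s → Irreducible (P + C t * X (⟨0, by omega⟩ : Fin n)) := by
  push Not at hnot
  obtain ⟨m, hm, i, hi, hmi⟩ := hnot
  have hP := pderiv_ne_zero_of_mem_support hm hmi
  have hfin : {t : K | ¬ Irreducible (P + C t * X (⟨0, by omega⟩ : Fin n))}.Finite := by
    by_contra hinf
    obtain ⟨T, hT, hcard⟩ := Set.Infinite.exists_subset_card_eq hinf (P.totalDegree ^ 2 - 1 + 1)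
    have := card_le_of_forall_not_irreducible hi hP hndvd fun t ht => hT ht
    omega
  exact ⟨hfin.toFinset, card_le_of_forall_not_irreducible hi hP hndvd fun t ht =>
    hfin.mem_toFinset.1 ht, fun t ht => by simpa using ht⟩
end
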